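/- arXiv:math/9409215 — 10 statements merged into one kernel-verified Lean document; each statement's English description precedes it below -/
import Mathlib

section
/- Let F be a finite intersection-closed family of finite sets with at least two members, and let X = ⋃F. If there exist elements x, y ∈ X (not necessarily distinct) such that X \ {x, y} ∈ F, then there exists z ∈ X with 2·|{A ∈ F : z ∈ A}| ≤ |F|. -/
/-- Intersecting with `X \ {x, y}` injects the members containing both `x` and `y` into the
members containing neither. -/
lemma card_filter_mem_and_le_card_filter_notMem {α : Type*} [DecidableEq α]
    (F : Finset (Finset α)) (hIC : ∀ A ∈ F, ∀ B ∈ F, A ∩ B ∈ F) (x y : α)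
    (hxy : (F.sup id) \ {x, y} ∈ F) :
    (F.filter (fun A => x ∈ A ∧ y ∈ A)).card ≤ (F.filter (fun A => ¬(x ∈ A ∨ y ∈ A))).card := by
  refine Finset.card_le_card_of_injOn (fun A => A ∩ (F.sup id \ {x, y})) ?_ ?_
  · intro A hA
    have hA' := Finset.mem_filter.1 hA
    refine Finset.mem_filter.2 ⟨hIC A hA'.1 _ hxy, ?_⟩
    simp
  · intro A hA B hB hAB
    have hA' := Finset.mem_filter.1 hA
    have hB' := Finset.mem_filter.1 hB
    have hAX : A ⊆ F.sup id := Finset.le_sup (f := id) hA'.1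
    have hBX : B ⊆ F.sup id := Finset.le_sup (f := id) hB'.1
    ext a
    have h := Finset.ext_iff.1 hAB a
    simp only [Finset.mem_inter, Finset.mem_sdiff, Finset.mem_insert,
      Finset.mem_singleton] at h
    have h1 := @hAX a
    have h2 := @hBX a
    by_cases hax : a = x
    · subst hax
      exact iff_of_true hA'.2.1 hB'.2.1
    by_cases hay : a = y
    · subst hay
      exact iff_of_true hA'.2.2 hB'.2.2
    tauto

/-- Theorem 2.6: if an intersection-closed family `F` (with at least two members)
contains `X \ {x, y}` for some `x, y ∈ X = ⋃ F`, then some `z ∈ X` has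
degree at most `|F| / 2`. -/
theorem stmt0 {α : Type*} [DecidableEq α] (F : Finset (Finset α))
    (hIC : ∀ A ∈ F, ∀ B ∈ F, A ∩ B ∈ F) (hcard : 2 ≤ F.card)
    (x y : α) (hx : x ∈ F.sup id) (hy : y ∈ F.sup id)
    (hxy : (F.sup id) \ {x, y} ∈ F) :
    ∃ z ∈ F.sup id, 2 * (F.filter (fun A => z ∈ A)).card ≤ F.card := by
  have hle := card_filter_mem_and_le_card_filter_notMem F hIC x y hxy
  have hsplit := Finset.card_filter_add_card_filter_not (s := F) (fun A => x ∈ A ∨ y ∈ A)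
  have hunion := Finset.card_union_add_card_inter
    (F.filter (fun A => x ∈ A)) (F.filter (fun A => y ∈ A))
  rw [← Finset.filter_or, ← Finset.filter_and] at hunion
  by_cases h : 2 * (F.filter (fun A => x ∈ A)).card ≤ F.card
  · exact ⟨x, hx, h⟩
  · exact ⟨y, hy, by omega⟩
end

section
/- Every finite modular lattice L with at least two elements has the P-density property for every finite poset P: there exists a join-irreducible element a ∈ L such that p(P)·|[a)^P| ≤ |L^P|. -/
/-- `a` is join-irreducible: either `{x | x < a}` has a greatest element, or
`{x | x < a} = ∅` and `a` is not the least element. -/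
def JoinIrred {L : Type*} [PartialOrder L] (a : L) : Prop :=
  (∃ b, b < a ∧ ∀ x, x < a → x ≤ b) ∨ ((∀ x, ¬ x < a) ∧ ∃ y, ¬ a ≤ y)

/-- In a finite lattice, an element minimal among those not below `m` is join-irreducible. -/
theorem exists_joinIrred_not_le {L : Type*} [Lattice L] [Finite L] {m t : L} (h : ¬ t ≤ m) :
    ∃ a : L, JoinIrred a ∧ ¬ a ≤ m := by
  obtain ⟨a, ha, hmin⟩ := wellFounded_lt.has_min {x : L | ¬ x ≤ m} ⟨t, h⟩
  refine ⟨a, Or.inl ⟨a ⊓ m, inf_lt_left.2 ha, fun x hx => le_inf hx.le ?_⟩, ha⟩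
  by_contra hxm
  exact hmin x hxm hx

open Classical in
/-- The monotone map that agrees with `f` on the upper set `U` and with `f ⊓ m` off `U`. -/
noncomputable def OrderHom.infOff {L P : Type*} [Lattice L] [PartialOrder P] (m : L)
    (U : UpperSet P) (f : P →o L) : P →o L where
  toFun x := if x ∈ U then f x else f x ⊓ m
  monotone' x y hxy := by
    have hf := f.monotone hxy
    by_cases hx : x ∈ U
    · have hy : y ∈ U := U.upper hxy hx
      simpa [hx, hy] using hf
    · by_cases hy : y ∈ U
      · simpa [hx, hy] using inf_le_left.trans hf
      · simpa only [hx, hy, if_false] using inf_le_inf_right m hf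

theorem OrderHom.infOff_of_mem {L P : Type*} [Lattice L] [PartialOrder P] (m : L)
    {U : UpperSet P} (f : P →o L) {x : P} (hx : x ∈ U) : f.infOff m U x = f x :=
  if_pos hx

theorem OrderHom.infOff_of_notMem {L P : Type*} [Lattice L] [PartialOrder P] (m : L)
    {U : UpperSet P} (f : P →o L) {x : P} (hx : x ∉ U) : f.infOff m U x = f x ⊓ m :=
  if_neg hx

theorem OrderHom.le_infOff_iff {L P : Type*} [Lattice L] [PartialOrder P] {a m : L}
    (ha : ¬ a ≤ m) (U : UpperSet P) {f : P →o L} (hf : ∀ x, a ≤ f x) (x : P) :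
    a ≤ f.infOff m U x ↔ x ∈ U := by
  by_cases hx : x ∈ U
  · simp [OrderHom.infOff_of_mem, hx, hf x]
  · simp [OrderHom.infOff_of_notMem, hx, ha]

/-- If `a ⊔ m` is the top element, then `f` is recovered from `f.infOff m U` by joining with `a`. -/
theorem OrderHom.sup_infOff {L P : Type*} [Lattice L] [IsModularLattice L] [PartialOrder P]
    {a m : L} (ham : ∀ y, y ≤ a ⊔ m) (U : UpperSet P) {f : P →o L} (hf : ∀ x, a ≤ f x) (x : P) :
    a ⊔ f.infOff m U x = f x := by
  by_cases hx : x ∈ U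
  · simp [OrderHom.infOff_of_mem, hx, hf x]
  · have h : a ⊔ m ⊓ f x = f x := by
      rw [← sup_inf_assoc_of_le m (hf x), inf_eq_right.2 (ham _)]
    rwa [OrderHom.infOff_of_notMem m f hx, inf_comm]

/-- Theorem 2.9 (modular lattices): every finite modular lattice with at least
two elements has the `P`-density property for every finite poset `P`. -/
theorem stmt2 (L : Type*) (P : Type*) [Lattice L] [Fintype L] [IsModularLattice L]
    (hL : 1 < Fintype.card L) [PartialOrder P] [Finite P] :
    ∃ a : L, JoinIrred a ∧
      Nat.card (UpperSet P) * Nat.card {f : P →o L // ∀ x, a ≤ f x} ≤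
        Nat.card (P →o L) := by
  have : Nontrivial L := Fintype.one_lt_card_iff_nontrivial.1 hL
  let _ : BoundedOrder L := Fintype.toBoundedOrder L
  obtain ⟨m, hm⟩ := IsCoatomic.exists_coatom L
  obtain ⟨a, hirr, ha⟩ := exists_joinIrred_not_le (m := m) (t := ⊤) (by simpa using hm.1)
  have ham : ∀ y, y ≤ a ⊔ m := fun y => by
    rw [hm.2 _ (right_lt_sup.2 ha)]
    exact le_top
  refine ⟨a, hirr, ?_⟩
  have : Finite (P →o L) := Finite.of_injective _ DFunLike.coe_injective
  rw [← Nat.card_prod]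
  refine Nat.card_le_card_of_injective
    (fun q : UpperSet P × {f : P →o L // ∀ x, a ≤ f x} => q.2.1.infOff m q.1) ?_
  rintro ⟨U, f, hf⟩ ⟨V, g, hg⟩ h
  have hfg : f.infOff m U = g.infOff m V := h
  have hUV : U = V := SetLike.ext fun x => by
    rw [← OrderHom.le_infOff_iff ha U hf, hfg, OrderHom.le_infOff_iff ha V hg]
  have hfg' : f = g := OrderHom.ext _ _ <| funext fun x => by
    rw [← OrderHom.sup_infOff ham U hf, hfg, OrderHom.sup_infOff ham V hg]
  subst hUV hfg'
  rfl
end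

section
/- Let P be a finite poset. If a finite meet-semilattice L with at least two elements has the P-density property, then for every finite meet-semilattice M the product meet-semilattice L × M (ordered componentwise) also has the P-density property. -/
/-- `L` has the `P`-density property. -/
def PDensityProp (P L : Type*) [PartialOrder P] [SemilatticeInf L] : Prop :=
  ∃ a : L, JoinIrred a ∧
    Nat.card (UpperSet P) * Nat.card {f : P →o L // ∀ x, a ≤ f x} ≤
      Nat.card (P →o L)

theorem exists_isBot_of_finite (M : Type*) [SemilatticeInf M] [Finite M] [Nonempty M] :
    ∃ m : M, IsBot m :=
  (Finite.to_wellFoundedLT (α := M)).wf.has_min Set.univ Set.univ_nonempty |>.imp fun m hm y =>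
    inf_eq_left.1 (inf_le_left.eq_of_not_lt (hm.2 (m ⊓ y) trivial))

theorem JoinIrred.prodMk_isBot {L M : Type*} [SemilatticeInf L] [PartialOrder M] {a : L}
    (ha : JoinIrred a) {m : M} (hm : IsBot m) : JoinIrred (a, m) := by
  rcases ha with ⟨b, hba, hb⟩ | ⟨hmin, y, hy⟩
  · refine Or.inl ⟨(b, m), Prod.mk_lt_mk_iff_left.2 hba, ?_⟩
    rintro ⟨x, y⟩ hxy
    obtain rfl : y = m := le_antisymm hxy.le.2 (hm y)
    exact ⟨hb x (Prod.mk_lt_mk_iff_left.1 hxy), le_rfl⟩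
  · exact absurd (inf_eq_left.1 (inf_le_left.eq_of_not_lt (hmin (a ⊓ y)))) hy

/-- Order-preserving maps into `L × M` lying above `(a, m)`, with `m` the least element of `M`,
split into a map into `L` above `a` and an arbitrary map into `M`. -/
def orderHomAboveProdEquiv (P : Type*) {L M : Type*} [PartialOrder P] [PartialOrder L]
    [PartialOrder M] (a : L) {m : M} (hm : IsBot m) :
    {f : P →o L × M // ∀ x, (a, m) ≤ f x} ≃ {f : P →o L // ∀ x, a ≤ f x} × (P →o M) where
  toFun f := (⟨OrderHom.fst.comp f.1, fun x => (f.2 x).1⟩, OrderHom.snd.comp f.1)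
  invFun g := ⟨g.1.1.prod g.2, fun x => ⟨g.1.2 x, hm _⟩⟩
  left_inv _ := rfl
  right_inv _ := rfl

/-- Theorem 2.10: if the finite meet-semilattice `L` (with at least two elements)
has the `P`-density property, then so does `L × M` for any finite meet-semilattice `M`. -/
theorem stmt3 (P L M : Type*) [PartialOrder P] [Finite P]
    [SemilatticeInf L] [Finite L] (hL : 1 < Nat.card L)
    [SemilatticeInf M] [Finite M] [Nonempty M]
    (h : PDensityProp P L) : PDensityProp P (L × M) := by
  obtain ⟨a, ha, hle⟩ := h
  obtain ⟨m, hm⟩ := exists_isBot_of_finite M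
  refine ⟨(a, m), ha.prodMk_isBot hm, ?_⟩
  rw [Nat.card_congr (orderHomAboveProdEquiv P a hm),
    Nat.card_congr (OrderHom.prodIso (α := P) (β := L) (γ := M)).toEquiv,
    Nat.card_prod, Nat.card_prod, ← mul_assoc]
  exact Nat.mul_le_mul_right _ hle
end

section
/- For every finite lattice L with at least two elements there exists N ∈ ℕ such that for all n ≥ N, L has the [n]-density property: there exists a join-irreducible a ∈ L such that (n+1)·|{order-preserving maps from the n-element chain {1,…,n} to L all of whose values are ≥ a}| ≤ |{order-preserving maps from {1,…,n} to L}|. -/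
open Finset in
open Classical in
/-- The number of strict chains with `j` steps that start at `q`. -/
noncomputable def chainCount {L : Type*} [PartialOrder L] [Fintype L] : ℕ → L → ℕ
  | 0, _ => 1
  | j + 1, q => ∑ r ∈ univ.filter (fun r => q < r), chainCount j r

/-- The number of monotone maps `Fin n → L` with all values above `a`. -/
noncomputable def countAbove {L : Type*} [PartialOrder L] (n : ℕ) (a : L) : ℕ :=
  Nat.card {f : Fin n →o L // ∀ x, a ≤ f x}

theorem countAbove_bot {L : Type*} [PartialOrder L] [OrderBot L] (n : ℕ) : countAbove n (⊥ : L) = Nat.card (Fin n →o L) :=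
  Nat.card_congr (Equiv.subtypeUnivEquiv fun _ _ => bot_le)

/-- A monotone map on `Fin (n + 1)` is its first value together with its tail. -/
def consEquiv {L : Type*} [PartialOrder L] (n : ℕ) (a : L) :
    {f : Fin (n + 1) →o L // ∀ x, a ≤ f x} ≃
      Σ r : {r : L // a ≤ r}, {f : Fin n →o L // ∀ x, r.1 ≤ f x} where
  toFun f := ⟨⟨f.1 0, f.2 0⟩, ⟨⟨fun i => f.1 i.succ, fun i j h =>
    f.1.monotone (Fin.succ_le_succ_iff.2 h)⟩, fun i => f.1.monotone (Fin.zero_le _)⟩⟩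
  invFun p := ⟨⟨Fin.cons p.1.1 p.2.1, by
      intro i j h
      induction i using Fin.cases with
      | zero =>
        induction j using Fin.cases with
        | zero => simp
        | succ j => simpa using p.2.2 j
      | succ i =>
        induction j using Fin.cases with
        | zero => exact absurd h (by simp)
        | succ j => simpa using p.2.1.monotone (Fin.succ_le_succ_iff.1 h)⟩, by
      intro i
      induction i using Fin.cases with
      | zero => exact p.1.2
      | succ i => exact p.1.2.trans (p.2.2 i)⟩
  left_inv f := by
    ext i
    induction i using Fin.cases <;> rfl
  right_inv p := by
    rcases p with ⟨⟨r, hr⟩, ⟨f, hf⟩⟩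
    rfl

section Counting

open Finset

theorem countAbove_zero {L : Type*} [PartialOrder L] (a : L) : countAbove 0 a = 1 := by
  unfold countAbove
  rw [Nat.card_eq_one_iff_unique]
  refine ⟨⟨fun f g => ?_⟩, ⟨⟨⟨fun i => i.elim0, fun i => i.elim0⟩, fun i => i.elim0⟩⟩⟩
  ext i
  exact i.elim0

variable {L : Type*} [PartialOrder L] [Fintype L]

open Classical in
theorem countAbove_succ (n : ℕ) (a : L) :
    countAbove (n + 1) a = ∑ r ∈ univ.filter (fun r => a ≤ r), countAbove n r := by
  have : Finite (Fin n →o L) := DFunLike.finite _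
  unfold countAbove
  rw [Nat.card_congr (consEquiv n a), Nat.card_sigma]
  exact (Finset.sum_subtype _ (by simp)
    (fun r => Nat.card {f : Fin n →o L // ∀ x, r ≤ f x})).symm

open Classical in
theorem chainCount_succ (j : ℕ) (q : L) :
    chainCount (j + 1) q = ∑ r ∈ univ.filter (fun r => q < r), chainCount j r := by
  rw [chainCount]

theorem countAbove_eq_sum (n : ℕ) (a : L) :
    countAbove n a = ∑ j ∈ range (n + 1), chainCount j a * n.choose j := by
  classical
  induction n generalizing a with
  | zero => simp [countAbove_zero, chainCount]
  | succ n ih =>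
    have hs : univ.filter (fun r => a ≤ r) = insert a (univ.filter (fun r => a < r)) := by
      ext r
      simp [le_iff_eq_or_lt, eq_comm]
    have h1 : ∑ r ∈ univ.filter (fun r => a < r), countAbove n r =
        ∑ j ∈ range (n + 1), chainCount (j + 1) a * n.choose j := by
      simp_rw [ih, chainCount_succ, Finset.sum_mul]
      exact Finset.sum_comm
    have h2 : countAbove n a =
        ∑ j ∈ range (n + 1), chainCount (j + 1) a * n.choose (j + 1) + chainCount 0 a := by
      have := Finset.sum_range_succ' (fun j => chainCount j a * n.choose j) (n + 1)
      rw [Finset.sum_range_succ] at this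
      simpa [ih] using this
    rw [countAbove_succ, hs, Finset.sum_insert (by simp), h1, h2, Finset.sum_range_succ' _ (n + 1)]
    simp only [Nat.choose_succ_succ, mul_add, Finset.sum_add_distrib]
    simp
    ring

theorem chainCount_pos_of_lt {j : ℕ} {q r : L} (h : q < r) (hr : 0 < chainCount j r) :
    0 < chainCount (j + 1) q := by
  classical
  rw [chainCount_succ]
  exact Finset.sum_pos_iff.2 ⟨r, by simpa using h, hr⟩

theorem exists_gt_of_chainCount_pos {j : ℕ} {q : L} (h : 0 < chainCount (j + 1) q) :
    ∃ r, q < r ∧ 0 < chainCount j r := by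
  classical
  rw [chainCount_succ] at h
  simpa using Finset.sum_pos_iff.1 h

/-- A strictly monotone rank function bounds the length of a chain. -/
theorem exists_lt_of_chainCount_pos {μ : L → ℕ} (hμ : StrictMono μ) {j : ℕ} {q : L}
    (h : 0 < chainCount (j + 1) q) : ∃ d e : L, d < e ∧ μ q + j ≤ μ d := by
  induction j generalizing q with
  | zero =>
    obtain ⟨r, hr, -⟩ := exists_gt_of_chainCount_pos h
    exact ⟨q, r, hr, le_rfl⟩
  | succ j ih =>
    obtain ⟨r, hr, hr'⟩ := exists_gt_of_chainCount_pos h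
    obtain ⟨d, e, hde, hd⟩ := ih hr'
    exact ⟨d, e, hde, by have := hμ hr; omega⟩

theorem chainCount_eq_zero_of_card_lt {j : ℕ} (hj : Fintype.card L < j) (q : L) :
    chainCount j q = 0 := by
  classical
  by_contra h
  obtain ⟨k, rfl⟩ : ∃ k, j = k + 1 := ⟨j - 1, by omega⟩
  have hμ : StrictMono fun q : L => #(univ.filter (fun r => r ≤ q)) := fun a b hab =>
    Finset.card_lt_card <| Finset.ssubset_iff_of_subset
      (fun r hr => by simp at hr ⊢; exact hr.trans hab.le) |>.2 ⟨b, by simp, by simpa using hab.not_ge⟩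
  obtain ⟨d, e, hde, hd⟩ := exists_lt_of_chainCount_pos hμ (Nat.pos_of_ne_zero h)
  have h1 := hμ hde
  have h2 : #(univ.filter (fun r => r ≤ e)) ≤ Fintype.card L := Finset.card_le_univ _
  simp only at h1 hd
  omega

/-- The height of a finite poset with bottom: the greatest length of a chain from `⊥`. -/
theorem exists_height [OrderBot L] [Nontrivial L] :
    ∃ D, 0 < chainCount (D + 1) (⊥ : L) ∧ ∀ j, D + 1 < j → chainCount j (⊥ : L) = 0 := by
  classical
  obtain ⟨x, hx⟩ := exists_ne (⊥ : L)
  have h1 : 0 < chainCount 1 (⊥ : L) :=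
    chainCount_pos_of_lt (bot_lt_iff_ne_bot.2 hx) (by simp [chainCount])
  let P : ℕ → Prop := fun j => 0 < chainCount j (⊥ : L)
  have hb : ∀ j, P j → j ≤ Fintype.card L := fun j hj => by
    by_contra h
    exact hj.ne' (chainCount_eq_zero_of_card_lt (by omega) _)
  have hle : 1 ≤ Nat.findGreatest P (Fintype.card L) := Nat.le_findGreatest (hb 1 h1) h1
  refine ⟨Nat.findGreatest P (Fintype.card L) - 1, ?_, fun j hj => ?_⟩
  · rw [Nat.sub_add_cancel hle]
    exact Nat.findGreatest_spec (P := P) (hb 1 h1) h1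
  · by_contra h
    have hP : P j := Nat.pos_of_ne_zero h
    have := Nat.le_findGreatest (hb j hP) hP
    omega

end Counting

section Asymptotics

open Finset

theorem choose_le_choose_of_two_mul_le {n j D : ℕ} (hj : j ≤ D) (hn : 2 * D ≤ n) :
    n.choose j ≤ n.choose D := by
  induction D, hj using Nat.le_induction with
  | base => exact le_rfl
  | succ D _ ih =>
    exact (ih (by omega)).trans (Nat.choose_le_succ_of_lt_half_left (by omega))

theorem mul_choose_le_choose_succ {n D K : ℕ} (hn : D + K * (D + 1) ≤ n) :
    K * n.choose D ≤ n.choose (D + 1) := by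
  have h := Nat.choose_succ_right_eq n D
  have h2 : K * (D + 1) ≤ n - D := by omega
  refine Nat.le_of_mul_le_mul_right (c := D + 1) ?_ (Nat.succ_pos D)
  rw [h]
  calc K * n.choose D * (D + 1) = n.choose D * (K * (D + 1)) := by ring
    _ ≤ _ := Nat.mul_le_mul_left _ h2

theorem succ_mul_choose_eq_add (n j : ℕ) :
    (n + 1) * n.choose j = (j + 1) * (n.choose j + n.choose (j + 1)) := by
  rw [Nat.add_one_mul_choose_eq, Nat.choose_succ_succ, mul_comm]

/-- Multiplying a combination of binomials of degree at most `D` by `n + 1` multiplies its leading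
coefficient by `D + 1`. -/
theorem exists_succ_mul_sum_choose_le (c : ℕ → ℕ) (D b : ℕ) (h : (D + 1) * c D < b) :
    ∃ N, ∀ n ≥ N, (n + 1) * ∑ j ∈ range (D + 1), c j * n.choose j ≤ b * n.choose (D + 1) := by
  set K := ∑ j ∈ range (D + 1), 2 * (c j * (j + 1)) with hK
  refine ⟨2 * D + K * (D + 1), fun n hn => ?_⟩
  have hKn := mul_choose_le_choose_succ (n := n) (D := D) (K := K) (by omega)
  have hmono : ∀ j ≤ D, n.choose j ≤ n.choose D := fun j hj =>
    choose_le_choose_of_two_mul_le hj (by omega)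
  have hlow : ∑ j ∈ range D, c j * (j + 1) * (n.choose j + n.choose (j + 1)) ≤
      (∑ j ∈ range D, 2 * (c j * (j + 1))) * n.choose D := by
    rw [Finset.sum_mul]
    refine Finset.sum_le_sum fun j hj => ?_
    have hj := Finset.mem_range.1 hj
    have h1 := hmono j (by omega)
    have h2 := hmono (j + 1) (by omega)
    calc _ ≤ c j * (j + 1) * (2 * n.choose D) := Nat.mul_le_mul_left _ (by omega)
      _ = _ := by ring
  calc (n + 1) * ∑ j ∈ range (D + 1), c j * n.choose j
      = ∑ j ∈ range (D + 1), c j * (j + 1) * (n.choose j + n.choose (j + 1)) := by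
        rw [Finset.mul_sum]
        refine Finset.sum_congr rfl fun j _ => ?_
        rw [mul_left_comm, succ_mul_choose_eq_add, mul_assoc]
    _ ≤ K * n.choose D + (D + 1) * c D * n.choose (D + 1) := by
        rw [hK, Finset.sum_range_succ, Finset.sum_range_succ]
        nlinarith [Nat.zero_le (c D * (D + 1) * n.choose D)]
    _ ≤ ((D + 1) * c D + 1) * n.choose (D + 1) := by
        linarith
    _ ≤ b * n.choose (D + 1) := Nat.mul_le_mul_right _ h

end Asymptotics

section Lattice

open Finset

variable {L : Type*} [Lattice L] [Fintype L]

theorem SupIrred.joinIrred [OrderBot L] {a : L} (ha : SupIrred a) : JoinIrred a := by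
  classical
  refine Or.inl ⟨(univ.filter (fun x => x < a)).sup id, ?_, fun x hx =>
    Finset.le_sup (f := id) (by simpa using hx)⟩
  refine lt_of_le_of_ne (Finset.sup_le fun x hx => ?_) fun h => ?_
  · simpa using (Finset.mem_filter.1 hx).2.le
  · obtain ⟨i, hi, rfl⟩ := ha.finset_sup_eq h
    simp at hi

theorem le_of_forall_supIrred_le [OrderBot L] {y z : L}
    (h : ∀ b, SupIrred b → b ≤ y → b ≤ z) : y ≤ z := by
  obtain ⟨s, rfl, hs⟩ := exists_supIrred_decomposition y
  exact Finset.sup_le fun b hb => h b (hs hb) (Finset.le_sup (f := id) hb)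

open Classical in
theorem strictMono_card_supIrred_le [OrderBot L] :
    StrictMono fun q : L => #(univ.filter (fun b => SupIrred b ∧ b ≤ q)) := by
  intro p q hpq
  refine Finset.card_lt_card <| (Finset.ssubset_iff_of_subset fun r hr => ?_).2 ?_
  · simp only [mem_filter_univ] at hr ⊢
    exact ⟨hr.1, hr.2.trans hpq.le⟩
  · by_contra! h
    refine hpq.not_ge (le_of_forall_supIrred_le fun b hb hbq => ?_)
    have := h b (by simp [hb, hbq])
    simp at this
    exact this.2

/-- If `y ↦ y ⊓ d` on the elements above `x` is undone by joining with `x`, then the maps above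
`x` can be lowered independently on each of the `n + 1` initial segments. -/
theorem succ_mul_card_le_of_inf_sup_eq {x d : L} (hxd : ¬ x ≤ d)
    (h : ∀ y, x ≤ y → (y ⊓ d) ⊔ x = y) (n : ℕ) :
    (n + 1) * Nat.card {f : Fin n →o L // ∀ i, x ≤ f i} ≤ Nat.card (Fin n →o L) := by
  have : Finite (Fin n →o L) := DFunLike.finite _
  let g : Fin (n + 1) × {f : Fin n →o L // ∀ i, x ≤ f i} → (Fin n →o L) := fun p =>
    ⟨fun k => if k.castSucc < p.1 then p.2.1 k ⊓ d else p.2.1 k, fun k l hkl => by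
      have hm := p.2.1.monotone hkl
      have hc : k.castSucc ≤ l.castSucc := hkl
      dsimp only
      split_ifs with h1 h2 h2
      · exact inf_le_inf_right d hm
      · exact inf_le_left.trans hm
      · exact absurd (hc.trans_lt h2) h1
      · exact hm⟩
  have hg_sup : ∀ p k, g p k ⊔ x = p.2.1 k := by
    intro p k
    change (if k.castSucc < p.1 then p.2.1 k ⊓ d else p.2.1 k) ⊔ x = p.2.1 k
    split_ifs
    · exact h _ (p.2.2 k)
    · exact sup_eq_left.2 (p.2.2 k)
  have hg_lt : ∀ p k, k.castSucc < p.1 ↔ ¬ x ≤ g p k := by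
    intro p k
    change _ ↔ ¬ x ≤ (if k.castSucc < p.1 then p.2.1 k ⊓ d else p.2.1 k)
    split_ifs with h1
    · exact iff_of_true h1 fun hx => hxd (hx.trans inf_le_right)
    · exact iff_of_false h1 (not_not.2 (p.2.2 k))
  have hg : Function.Injective g := by
    intro p q hpq
    refine Prod.ext ?_ (Subtype.ext (OrderHom.ext _ _ (funext fun k => ?_)))
    · have key : ∀ k : Fin n, k.castSucc < p.1 ↔ k.castSucc < q.1 := fun k => by
        rw [hg_lt, hg_lt, hpq]
      refine le_antisymm ?_ ?_
      · by_contra! hlt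
        have := (key ⟨q.1, by have := p.1.2; omega⟩).1 hlt
        exact lt_irrefl _ this
      · by_contra! hlt
        have := (key ⟨p.1, by have := q.1.2; omega⟩).2 hlt
        exact lt_irrefl _ this
    · rw [← hg_sup p, ← hg_sup q, hpq]
  simpa [Nat.card_prod] using Nat.card_le_card_of_injective g hg

end Lattice

/-- Theorem 2.14: for every finite lattice `L` with at least two elements there
is an `N` such that for all `n ≥ N`, `L` has the `[n]`-density property, where
the `n`-element chain `[n]` is represented by `Fin n` (it has `n + 1` up-sets). -/
theorem stmt4 (L : Type*) [Lattice L] [Fintype L] (hL : 1 < Fintype.card L) :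
    ∃ N : ℕ, ∀ n ≥ N, ∃ a : L, JoinIrred a ∧
      (n + 1) * Nat.card {f : Fin n →o L // ∀ x, a ≤ f x} ≤
        Nat.card (Fin n →o L) := by
  classical
  have : Nontrivial L := Fintype.one_lt_card_iff_nontrivial.1 hL
  let : OrderBot L := Fintype.toOrderBot L
  obtain ⟨D, hD, hD0⟩ := exists_height (L := L)
  by_cases hcase : ∃ a : L, SupIrred a ∧ (D + 1) * chainCount D a < chainCount (D + 1) (⊥ : L)
  · obtain ⟨a, ha, hlt⟩ := hcase
    obtain ⟨N, hN⟩ := exists_succ_mul_sum_choose_le (fun j => chainCount j a) D _ hlt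
    refine ⟨N + D + 1, fun n hn => ⟨a, ha.joinIrred, ?_⟩⟩
    have ha0 : ∀ j, D < j → chainCount j a = 0 := fun j hj => by
      by_contra h
      exact (chainCount_pos_of_lt (bot_lt_iff_ne_bot.2 ha.ne_bot) (Nat.pos_of_ne_zero h)).ne'
        (hD0 (j + 1) (by omega))
    have hsum : countAbove n a = ∑ j ∈ Finset.range (D + 1), chainCount j a * n.choose j := by
      rw [countAbove_eq_sum]
      refine (Finset.sum_subset (Finset.range_subset_range.2 (by omega)) fun j _ hj => ?_).symm
      rw [ha0 j (by simpa using hj), zero_mul]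
    rw [← countAbove_bot]
    change (n + 1) * countAbove n a ≤ _
    rw [hsum]
    refine (hN n (by omega)).trans ?_
    rw [countAbove_eq_sum]
    exact Finset.single_le_sum (f := fun j => chainCount j (⊥ : L) * n.choose j)
      (fun _ _ => Nat.zero_le _) (Finset.mem_range.2 (by omega))
  · push Not at hcase
    set S : Finset L := Finset.univ.filter (fun b => SupIrred b) with hS
    have hcard : S.card ≤ D + 1 := by
      refine Nat.le_of_mul_le_mul_right (c := chainCount (D + 1) (⊥ : L)) ?_ hD
      calc S.card * chainCount (D + 1) (⊥ : L)
          = ∑ a ∈ S, chainCount (D + 1) (⊥ : L) := by simp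
        _ ≤ ∑ a ∈ S, (D + 1) * chainCount D a :=
            Finset.sum_le_sum fun a ha => hcase a (by simpa [hS] using ha)
        _ ≤ ∑ a ∈ Finset.univ.filter (fun r => (⊥ : L) < r), (D + 1) * chainCount D a := by
            refine Finset.sum_le_sum_of_subset fun a ha => ?_
            simp only [hS, Finset.mem_filter_univ] at ha ⊢
            exact bot_lt_iff_ne_bot.2 ha.ne_bot
        _ = (D + 1) * chainCount (D + 1) (⊥ : L) := by rw [chainCount_succ, Finset.mul_sum]
    obtain ⟨d, e, hde, hd⟩ := exists_lt_of_chainCount_pos strictMono_card_supIrred_le hD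
    obtain ⟨x, hx, hxd⟩ : ∃ x, SupIrred x ∧ ¬ x ≤ d := by
      by_contra! h
      exact hde.not_ge (le_of_forall_supIrred_le fun b hb _ => h b hb)
    have hother : ∀ b, SupIrred b → b ≠ x → b ≤ d := by
      intro b hb hbx
      by_contra hbd
      set T := Finset.univ.filter (fun b => SupIrred b ∧ b ≤ d) with hT
      have hsub : insert b (insert x T) ⊆ S := by
        intro r hr
        simp only [Finset.mem_insert, hT, hS, Finset.mem_filter_univ] at hr ⊢
        rcases hr with rfl | rfl | hr
        exacts [hb, hx, hr.1]
      have := Finset.card_le_card hsub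
      rw [Finset.card_insert_of_notMem (by simp [hT, hbx, hbd]),
        Finset.card_insert_of_notMem (by simp [hT, hxd])] at this
      omega
    refine ⟨0, fun n _ => ⟨x, hx.joinIrred, succ_mul_card_le_of_inf_sup_eq hxd (fun y hy => ?_) n⟩⟩
    refine le_antisymm (sup_le inf_le_left hy) (le_of_forall_supIrred_le fun b hb hby => ?_)
    by_cases hbx : b = x
    · exact hbx.le.trans le_sup_right
    · exact (le_inf hby (hother b hb hbx)).trans le_sup_left
end

section
/- Let F be a finite union-closed family of finite sets with ∅ ∈ F and |F| ≥ 2, and suppose F is graph-generated, i.e. every generator V ∈ J(F) has cardinality 1 or 2. Then there exists a generator U ∈ J(F) such that 2·|{A ∈ F : U ⊆ A}| ≤ |F|. -/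
open Finset

/-- `F` is union-closed. -/
def UnionClosed {α : Type*} [DecidableEq α] (F : Finset (Finset α)) : Prop :=
  ∀ A ∈ F, ∀ B ∈ F, A ∪ B ∈ F

/-- The generators `J(F)`: nonempty members of `F` that are not the union of the
members of `F` properly contained in them. -/
def gens {α : Type*} [DecidableEq α] (F : Finset (Finset α)) : Finset (Finset α) :=
  F.filter (fun U => U.Nonempty ∧ (F.filter (fun A => A ⊂ U)).sup id ≠ U)

/-- The closure `π_F(X)`: the union of all members of `F` contained in `X`. -/
def piF {α : Type*} [DecidableEq α] (F : Finset (Finset α)) (X : Finset α) : Finset α :=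
  (F.filter (fun A => A ⊆ X)).sup id

/-- `F ∨ H = {A ∪ B : A ∈ F, B ∈ H}`. -/
def famJoin {α : Type*} [DecidableEq α] (F H : Finset (Finset α)) : Finset (Finset α) :=
  (F ×ˢ H).image (fun p => p.1 ∪ p.2)

/-- `F'` is an extension of `(F, U)`: `F' = F ∨ H` for some nonempty union-closed
family `H` with `(⋃ H) ∩ U = ∅`. -/
def IsExtension {α : Type*} [DecidableEq α] (F : Finset (Finset α)) (U : Finset α)
    (F' : Finset (Finset α)) : Prop :=
  ∃ H : Finset (Finset α), H.Nonempty ∧ UnionClosed H ∧ (H.sup id) ∩ U = ∅ ∧ F' = famJoin F H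

/-- The restriction of `F` away from `U`: `F_{∖U} = {A ∖ U : A ∈ F}`. -/
def resAway {α : Type*} [DecidableEq α] (F : Finset (Finset α)) (U : Finset α) :
    Finset (Finset α) :=
  F.image (fun A => A \ U)

/-- `E_{F,U}(X)`: the subsets `Y ⊆ U` with `π_F(X ∪ Y) ∩ U = Y` and
`π_F(X ∪ Y) ⊇ π_F(X ∪ U) \ U`. -/
def Efam {α : Type*} [DecidableEq α] (F : Finset (Finset α)) (U X : Finset α) :
    Finset (Finset α) :=
  U.powerset.filter (fun Y => piF F (X ∪ Y) ∩ U = Y ∧ piF F (X ∪ U) \ U ⊆ piF F (X ∪ Y))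

/-- `μ_{F,F'}(U) = (Σ_{X ∈ F'_{∖U}} |E_{F,U}(X)|) / |F'_{∖U}|`. -/
def mu {α : Type*} [DecidableEq α] (F : Finset (Finset α)) (U : Finset α)
    (F' : Finset (Finset α)) : ℚ :=
  (∑ X ∈ resAway F' U, ((Efam F U X).card : ℚ)) / ((resAway F' U).card : ℚ)

/-- The union-closed family generated by `G` (all unions of subfamilies of `G`;
it contains `∅` as the empty union). -/
def genUC {α : Type*} [DecidableEq α] (G : Finset (Finset α)) : Finset (Finset α) :=
  G.powerset.image (fun S => S.sup id)

/-- The lattice neighborhood `𝒩_F(U)`: the union-closed family generated by `{∅}`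
together with the generators of `F` meeting `U`. -/
def latNbhd {α : Type*} [DecidableEq α] (F : Finset (Finset α)) (U : Finset α) :
    Finset (Finset α) :=
  genUC ((gens F).filter (fun V => (V ∩ U).Nonempty))

/-- The third lattice neighborhood `𝒩³_F(U) = 𝒩_F(⋃ 𝒩_F(U))`. -/
def latNbhd3 {α : Type*} [DecidableEq α] (F : Finset (Finset α)) (U : Finset α) :
    Finset (Finset α) :=
  latNbhd F ((latNbhd F U).sup id)

/-- The neighborhood `N_F(X) = X ∪ ⋃ {V ∈ J(F) : V ∩ X ≠ ∅}`. -/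
def nbhd {α : Type*} [DecidableEq α] (F : Finset (Finset α)) (X : Finset α) : Finset α :=
  X ∪ ((gens F).filter (fun V => (V ∩ X).Nonempty)).sup id

/-- `H` is a filter of `2^S`: a nonempty family of subsets of `S` closed upward in `S`. -/
def IsFilterOn {α : Type*} [DecidableEq α] (S : Finset α) (H : Finset (Finset α)) : Prop :=
  H.Nonempty ∧ (∀ X ∈ H, X ⊆ S) ∧ ∀ X ∈ H, ∀ Y, X ⊆ Y → Y ⊆ S → Y ∈ H

/-- `F'` minimizes `μ` in `D` (among extensions of `(F, U)` with union inside `D`). -/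
def MinimizesMu {α : Type*} [DecidableEq α] (F : Finset (Finset α)) (U D : Finset α)
    (F' : Finset (Finset α)) : Prop :=
  F'.sup id ⊆ D ∧ ∀ F'', IsExtension F U F'' → F''.sup id ⊆ D → mu F U F' ≤ mu F U F''

/-- The degree of `U` in the graph `G`: the number of members of `G` other than `U`
meeting `U`. -/
def degG {α : Type*} [DecidableEq α] (G : Finset (Finset α)) (U : Finset α) : ℕ :=
  (G.filter (fun V => V ≠ U ∧ (V ∩ U).Nonempty)).card

theorem sum_powerset_inv_card_succ {α : Type*} (P : Finset α) :
    ∑ J ∈ P.powerset, (1 / (#J + 1 : ℝ)) = (2 ^ (#P + 1) - 1) / (#P + 1) := by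
  rw [sum_powerset_apply_card (fun n => 1 / (n + 1 : ℝ))]
  rw [eq_div_iff (by positivity), sum_mul]
  have h := Nat.sum_range_choose (#P + 1)
  rw [sum_range_succ'] at h
  have h' : (∑ k ∈ range (#P + 1), ((#P + 1).choose (k + 1) : ℝ)) + 1 = 2 ^ (#P + 1) := by
    exact_mod_cast h
  rw [← h', add_sub_cancel_right]
  refine sum_congr rfl fun k _ => ?_
  have h2 : ((#P + 1 : ℝ)) * (#P).choose k = (#P + 1).choose (k + 1) * (k + 1) := by
    exact_mod_cast Nat.add_one_mul_choose_eq (#P) k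
  have : (k + 1 : ℝ) ≠ 0 := by positivity
  rw [nsmul_eq_mul]
  field_simp
  linarith

section FKG
variable {α : Type*} [DecidableEq α]

/-- Harris' inequality for two monotone functions on a power set. -/
theorem harris_powerset (N : Finset α) {f g : Finset α → ℝ} (hf₀ : ∀ s, 0 ≤ f s)
    (hg₀ : ∀ s, 0 ≤ g s) (hf : Monotone f) (hg : Monotone g) :
    (∑ s ∈ N.powerset, f s) * ∑ s ∈ N.powerset, g s ≤
      2 ^ #N * ∑ s ∈ N.powerset, f s * g s := by
  have h := Finset.four_functions_theorem N (f₁ := f) (f₂ := g) (f₃ := fun _ => (1 : ℝ))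
    (f₄ := fun s => f s * g s) hf₀ hg₀ (fun _ => zero_le_one)
    (fun s => mul_nonneg (hf₀ s) (hg₀ s))
    (fun s _ t _ => by
      simpa using mul_le_mul (hf subset_union_left) (hg subset_union_right) (hg₀ _) (hf₀ _))
    (𝒜 := N.powerset) (ℬ := N.powerset) Subset.rfl Subset.rfl
  simpa [powerset_sups_powerset_self, powerset_infs_powerset_self] using h

/-- The FKG inequality for two functions that are antitone on a power set. -/
theorem fkg_powerset_antitone (N : Finset α) {μ f g : Finset α → ℝ} (hμ₀ : ∀ s, 0 ≤ μ s)
    (hf₀ : ∀ s, 0 ≤ f s) (hg₀ : ∀ s, 0 ≤ g s)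
    (hf : ∀ ⦃s t⦄, s ⊆ t → t ⊆ N → f t ≤ f s) (hg : ∀ ⦃s t⦄, s ⊆ t → t ⊆ N → g t ≤ g s)
    (hμ : ∀ s t, μ s * μ t ≤ μ (s ∩ t) * μ (s ∪ t)) :
    (∑ s ∈ N.powerset, μ s * f s) * ∑ s ∈ N.powerset, μ s * g s ≤
      (∑ s ∈ N.powerset, μ s * (f s * g s)) * ∑ s ∈ N.powerset, μ s := by
  have h := Finset.four_functions_theorem N (f₁ := fun s => μ s * f s) (f₂ := fun s => μ s * g s)
    (f₃ := fun s => μ s * (f s * g s)) (f₄ := μ)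
    (fun s => mul_nonneg (hμ₀ s) (hf₀ s)) (fun s => mul_nonneg (hμ₀ s) (hg₀ s))
    (fun s => mul_nonneg (hμ₀ s) (mul_nonneg (hf₀ s) (hg₀ s))) hμ₀
    (fun s hs t ht => by
      have h1 : f s * g t ≤ f (s ∩ t) * g (s ∩ t) :=
        mul_le_mul (hf inter_subset_left hs) (hg inter_subset_right ht) (hg₀ _) (hf₀ _)
      calc μ s * f s * (μ t * g t) = μ s * μ t * (f s * g t) := by ring
        _ ≤ μ (s ∩ t) * μ (s ∪ t) * (f (s ∩ t) * g (s ∩ t)) :=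
          mul_le_mul (hμ s t) h1 (mul_nonneg (hf₀ _) (hg₀ _)) (mul_nonneg (hμ₀ _) (hμ₀ _))
        _ = _ := by ring)
    (𝒜 := N.powerset) (ℬ := N.powerset) Subset.rfl Subset.rfl
  simpa [powerset_sups_powerset_self, powerset_infs_powerset_self] using h

theorem card_filter_inter_nonempty {K B : Finset α} (hB : B ⊆ K) :
    (#{M ∈ K.powerset | (M ∩ B).Nonempty} : ℝ) = 2 ^ #K * (1 - (1 / 2) ^ #B) := by
  have h1 : {M ∈ K.powerset | ¬(M ∩ B).Nonempty} = (K \ B).powerset := by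
    ext M
    simp only [mem_filter, mem_powerset, not_nonempty_iff_eq_empty, ← disjoint_iff_inter_eq_empty,
      subset_sdiff]
  have h2 := card_filter_add_card_filter_not (s := K.powerset) (fun M => (M ∩ B).Nonempty)
  rw [h1, card_powerset, card_powerset] at h2
  have h3 : (2 : ℝ) ^ #K = 2 ^ #(K \ B) * 2 ^ #B := by
    rw [← pow_add, card_sdiff_add_card_eq_card hB]
  have h4 : (#{M ∈ K.powerset | (M ∩ B).Nonempty} : ℝ) + 2 ^ #(K \ B) = 2 ^ #K := by
    exact_mod_cast h2
  have h5 : (2 : ℝ) ^ #B * (1 / 2) ^ #B = 1 := by rw [← mul_pow]; norm_num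
  calc _ = (2 : ℝ) ^ #K - 2 ^ #(K \ B) := by linarith
    _ = 2 ^ #K - 2 ^ #(K \ B) * (2 ^ #B * (1 / 2) ^ #B) := by rw [h5, mul_one]
    _ = _ := by rw [h3]; ring

/-- The events `M ∩ B i ≠ ∅` are positively correlated for a uniformly random `M ⊆ K`. -/
theorem card_hitting_ge {ι : Type*} [DecidableEq ι] (s : Finset ι) (B : ι → Finset α)
    (K : Finset α) (hB : ∀ i ∈ s, B i ⊆ K) :
    (2 : ℝ) ^ #K * ∏ i ∈ s, (1 - (1 / 2 : ℝ) ^ #(B i)) ≤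
      #{M ∈ K.powerset | ∀ i ∈ s, (M ∩ B i).Nonempty} := by
  induction s using Finset.induction_on with
  | empty => simp
  | insert j s hj ih =>
    have ih := ih fun i hi => hB i (mem_insert_of_mem hi)
    have hmono : ∀ (B : Finset α) ⦃M M' : Finset α⦄, M ≤ M' → (M ∩ B).Nonempty →
        (M' ∩ B).Nonempty := fun B M M' h hM => hM.mono (inter_subset_inter_right h)
    have h := harris_powerset K (f := fun M => if ∀ i ∈ s, (M ∩ B i).Nonempty then 1 else 0)
      (g := fun M => if (M ∩ B j).Nonempty then 1 else 0)
      (fun _ => by positivity) (fun _ => by positivity)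
      (fun M M' h => by
        dsimp only
        split_ifs with h1 h2
        · exact le_rfl
        · exact absurd (fun i hi => hmono _ h (h1 i hi)) h2
        · exact zero_le_one
        · exact le_rfl)
      (fun M M' h => by
        dsimp only
        split_ifs with h1 h2
        · exact le_rfl
        · exact absurd (hmono _ h h1) h2
        · exact zero_le_one
        · exact le_rfl)
    simp only [mul_ite, mul_one, mul_zero, ← ite_and, sum_boole] at h
    rw [card_filter_inter_nonempty (hB j (mem_insert_self _ _))] at h
    have h0 : (0 : ℝ) ≤ 1 - (1 / 2) ^ #(B j) :=
      sub_nonneg.2 (pow_le_one₀ (by norm_num) (by norm_num))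
    have h2 : {M ∈ K.powerset | ∀ i ∈ insert j s, (M ∩ B i).Nonempty} =
        {M ∈ K.powerset | (M ∩ B j).Nonempty ∧ ∀ i ∈ s, (M ∩ B i).Nonempty} := by
      simp
    rw [prod_insert hj, h2]
    have hK : (0 : ℝ) < 2 ^ #K := by positivity
    refine le_of_mul_le_mul_left (le_trans ?_ h) hK
    calc (2 : ℝ) ^ #K * (2 ^ #K * ((1 - (1 / 2) ^ #(B j)) * ∏ i ∈ s, (1 - (1 / 2 : ℝ) ^ #(B i))))
        = (2 ^ #K * ∏ i ∈ s, (1 - (1 / 2 : ℝ) ^ #(B i))) * (2 ^ #K * (1 - (1 / 2) ^ #(B j))) := by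
          ring
      _ ≤ _ := mul_le_mul_of_nonneg_right ih (by positivity)

theorem sum_powerset_union_mul {P Q : Finset α} (h : Disjoint P Q) (f g : Finset α → ℝ) :
    ∑ J ∈ (P ∪ Q).powerset, f (J ∩ P) * g (J ∩ Q) =
      (∑ S ∈ P.powerset, f S) * ∑ T ∈ Q.powerset, g T := by
  rw [sum_mul_sum, ← sum_product']
  refine sum_nbij' (fun J => (J ∩ P, J ∩ Q)) (fun x => x.1 ∪ x.2) ?_ ?_ ?_ ?_ ?_
  · intro J _
    simp
  · intro x hx
    simp only [mem_product, mem_powerset] at hx ⊢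
    exact union_subset_union hx.1 hx.2
  · intro J hJ
    rw [← inter_union_distrib_left, inter_eq_left.2 (mem_powerset.1 hJ)]
  · rintro ⟨S, T⟩ hx
    simp only [mem_product, mem_powerset] at hx
    have h1 : T ∩ P = ∅ := disjoint_iff_inter_eq_empty.1 (h.mono_right hx.2).symm
    have h2 : S ∩ Q = ∅ := disjoint_iff_inter_eq_empty.1 (h.mono_left hx.1)
    simp [union_inter_distrib_right, h1, h2, inter_eq_left.2 hx.1, inter_eq_left.2 hx.2]
  · intro J _
    rfl

theorem inv_card_succ_log_supermodular (s t : Finset α) :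
    1 / (#s + 1 : ℝ) * (1 / (#t + 1)) ≤ 1 / (#(s ∩ t) + 1) * (1 / (#(s ∪ t) + 1)) := by
  rw [one_div_mul_one_div, one_div_mul_one_div]
  refine one_div_le_one_div_of_le (by positivity) ?_
  have h1 : (#(s ∪ t) + #(s ∩ t) : ℝ) = #s + #t := by exact_mod_cast card_union_add_card_inter s t
  have h2 : (#(s ∩ t) : ℝ) ≤ #s := by exact_mod_cast card_le_card inter_subset_left
  have h3 : (#(s ∩ t) : ℝ) ≤ #t := by exact_mod_cast card_le_card inter_subset_right
  nlinarith

theorem antitone_succ_mul_half_pow : Antitone fun n : ℕ => ((n : ℝ) + 1) * (1 / 2) ^ n := by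
  refine antitone_nat_of_succ_le fun n => ?_
  rw [pow_succ]
  push_cast
  have : (0 : ℝ) ≤ (1 / 2) ^ n := by positivity
  nlinarith [mul_nonneg (Nat.cast_nonneg (α := ℝ) n) this]

/-- On a simplicial complex, the weight `1 / ((|S| + 1) (|T| + 1))` compared with `2 ^ (-|J|)` is
largest for the full simplex. -/
theorem sum_complex_le {P Q : Finset α} (hPQ : Disjoint P Q) (I : Finset α → Prop)
    [DecidablePred I] (hI : ∀ ⦃s t⦄, s ⊆ t → t ⊆ P ∪ Q → I t → I s) :
    (∑ J ∈ (P ∪ Q).powerset with I J, 1 / (#(J ∩ P) + 1 : ℝ) * (1 / (#(J ∩ Q) + 1))) *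
        (3 / 2) ^ (#P + #Q) ≤
      (∑ J ∈ (P ∪ Q).powerset with I J, (1 / 2 : ℝ) ^ #J) *
        ((2 ^ (#P + 1) - 1) / (#P + 1) * ((2 ^ (#Q + 1) - 1) / (#Q + 1))) := by
  set a : ℕ → ℝ := fun n => ((n : ℝ) + 1) * (1 / 2) ^ n with ha
  have ha₀ : ∀ n, 0 ≤ a n := fun n => by positivity
  have hcard : ∀ J ∈ (P ∪ Q).powerset, #(J ∩ P) + #(J ∩ Q) = #J := by
    intro J hJ
    rw [← card_union_of_disjoint (hPQ.mono inter_subset_right inter_subset_right),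
      ← inter_union_distrib_left, inter_eq_left.2 (mem_powerset.1 hJ)]
  have hmul : ∀ J ∈ (P ∪ Q).powerset, 1 / (#(J ∩ P) + 1 : ℝ) * (1 / (#(J ∩ Q) + 1)) *
      (a #(J ∩ P) * a #(J ∩ Q)) = (1 / 2) ^ #J := by
    intro J hJ
    rw [← hcard J hJ, pow_add, ha]
    field_simp
  have h := fkg_powerset_antitone (P ∪ Q)
    (μ := fun J => 1 / (#(J ∩ P) + 1 : ℝ) * (1 / (#(J ∩ Q) + 1)))
    (f := fun J => if I J then 1 else 0) (g := fun J => a #(J ∩ P) * a #(J ∩ Q))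
    (fun _ => by positivity) (fun _ => by positivity) (fun _ => mul_nonneg (ha₀ _) (ha₀ _))
    (fun s t hst ht => by
      split_ifs with h1 h2
      · exact le_rfl
      · exact absurd (hI hst ht h1) h2
      · exact zero_le_one
      · exact le_rfl)
    (fun s t hst _ => mul_le_mul
      (antitone_succ_mul_half_pow (card_le_card (inter_subset_inter_right hst)))
      (antitone_succ_mul_half_pow (card_le_card (inter_subset_inter_right hst)))
      (ha₀ _) (ha₀ _))
    (fun s t => by
      have h1 := inv_card_succ_log_supermodular (s ∩ P) (t ∩ P)
      have h2 := inv_card_succ_log_supermodular (s ∩ Q) (t ∩ Q)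
      rw [← inter_inter_distrib_right, ← union_inter_distrib_right] at h1 h2
      calc _ = (1 / (#(s ∩ P) + 1 : ℝ) * (1 / (#(t ∩ P) + 1))) *
            (1 / (#(s ∩ Q) + 1 : ℝ) * (1 / (#(t ∩ Q) + 1))) := by ring
        _ ≤ _ := mul_le_mul h1 h2 (by positivity) (by positivity)
        _ = _ := by ring)
  rw [sum_congr rfl hmul] at h
  have h3 : ∑ J ∈ (P ∪ Q).powerset, (1 / 2 : ℝ) ^ #J = (3 / 2) ^ (#P + #Q) := by
    have := sum_pow_mul_eq_add_pow (1 / 2 : ℝ) 1 (P ∪ Q)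
    simp only [one_pow, mul_one] at this
    rw [this, card_union_of_disjoint hPQ]
    norm_num
  have h4 := sum_powerset_union_mul hPQ (fun S => 1 / (#S + 1 : ℝ)) (fun S => 1 / (#S + 1 : ℝ))
  rw [sum_powerset_inv_card_succ, sum_powerset_inv_card_succ] at h4
  rw [h3, h4] at h
  convert h using 2
  · rw [sum_filter]
    exact sum_congr rfl fun J _ => by simp
  · rw [sum_filter]
    refine sum_congr rfl fun J hJ => ?_
    rw [← hmul J hJ]
    split_ifs <;> simp

end FKG

theorem near_pair_bound {p q c k x y : ℕ} (hx : q + 1 + c ≤ x) (hy : p + 1 + c ≤ y)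
    (hxk : x ≤ k) (hyk : y ≤ k) :
    (2 : ℝ) ^ c * ((2 ^ (p + 1) - 1) * (2 ^ (q + 1) - 1)) ≤
      2 * (3 / 2) ^ (p + q) * (2 ^ k * ((1 - (1 / 2) ^ x) * (1 - (1 / 2) ^ y))) := by
  have e : ∀ n : ℕ, (2 : ℝ) ^ n - 1 = 2 ^ n * (1 - (1 / 2) ^ n) := fun n => by
    rw [mul_sub, ← mul_pow]; norm_num
  have mono : ∀ m n : ℕ, m ≤ n → (1 : ℝ) - (1 / 2) ^ m ≤ 1 - (1 / 2) ^ n := fun m n h =>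
    sub_le_sub_left (pow_le_pow_of_le_one (by norm_num) (by norm_num) h) 1
  have nn : ∀ n : ℕ, (0 : ℝ) ≤ 1 - (1 / 2) ^ n := fun n =>
    sub_nonneg.2 (pow_le_one₀ (by norm_num) (by norm_num))
  have key : (2 : ℝ) ^ c * (2 ^ (p + 1) * 2 ^ (q + 1)) ≤ 2 * (3 / 2) ^ (p + q) * 2 ^ k := by
    refine (pow_le_pow_iff_left₀ (by positivity) (by positivity) two_ne_zero).1 ?_
    calc ((2 : ℝ) ^ c * (2 ^ (p + 1) * 2 ^ (q + 1))) ^ 2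
        = 4 * 2 ^ (p + q) * 2 ^ (p + q + 2 + 2 * c) := by ring
      _ ≤ 4 * (9 / 4) ^ (p + q) * 2 ^ (2 * k) := by
        gcongr
        · norm_num
        · norm_num
        · omega
      _ = (2 * (3 / 2) ^ (p + q) * 2 ^ k) ^ 2 := by
        rw [show (9 / 4 : ℝ) = (3 / 2) ^ 2 by norm_num, ← pow_mul]; ring
  rw [e, e]
  calc (2 : ℝ) ^ c * (2 ^ (p + 1) * (1 - (1 / 2) ^ (p + 1)) *
        (2 ^ (q + 1) * (1 - (1 / 2) ^ (q + 1))))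
      = 2 ^ c * (2 ^ (p + 1) * 2 ^ (q + 1)) *
          ((1 - (1 / 2) ^ (q + 1)) * (1 - (1 / 2) ^ (p + 1))) := by ring
    _ ≤ 2 * (3 / 2) ^ (p + q) * 2 ^ k * ((1 - (1 / 2) ^ x) * (1 - (1 / 2) ^ y)) := by
        refine mul_le_mul key ?_ (mul_nonneg (nn _) (nn _)) (by positivity)
        exact mul_le_mul (mono _ _ (by omega)) (mono _ _ (by omega)) (nn _) (nn _)
    _ = _ := by ring

section Isolated
variable {α : Type*} (adj : α → α → Prop) [DecidableRel adj]

/-- The members of `X` with no neighbour in `X`. -/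
def isolated (X : Finset α) : Finset α := {x ∈ X | ∀ y ∈ X, ¬adj x y}

/-- The neighbours of `x` in `W`. -/
abbrev nbrs (W : Finset α) (x : α) : Finset α := {y ∈ W | adj x y}

variable {adj}

theorem mem_isolated {X : Finset α} {x : α} :
    x ∈ isolated adj X ↔ x ∈ X ∧ ∀ y ∈ X, ¬adj x y := mem_filter

theorem isolated_subset (X : Finset α) : isolated adj X ⊆ X := filter_subset _ _

end Isolated

section Repairs
variable {α : Type*} [DecidableEq α] (adj : α → α → Prop) [DecidableRel adj]

/-- The choices of `M ⊆ K` giving every isolated point of `Z` a neighbour in `M`. -/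
def repairs (W K Z : Finset α) : Finset (Finset α) :=
  {M ∈ K.powerset | ∀ y ∈ isolated adj Z, (M ∩ nbrs adj W y).Nonempty}

/-- The subsets of `W` without isolated points that contain `a` and `b`. -/
def coveredWith (W : Finset α) (a b : α) : Finset (Finset α) :=
  {Y ∈ W.powerset | isolated adj Y = ∅ ∧ a ∈ Y ∧ b ∈ Y}

variable {adj} {W P Q C X Y Z K M J R : Finset α} {a b x y : α}

theorem mem_repairs : M ∈ repairs adj W K Z ↔
    M ⊆ K ∧ ∀ y ∈ isolated adj Z, (M ∩ nbrs adj W y).Nonempty := by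
  simp [repairs]

theorem mem_coveredWith : Y ∈ coveredWith adj W a b ↔
    Y ⊆ W ∧ isolated adj Y = ∅ ∧ a ∈ Y ∧ b ∈ Y := by
  simp [coveredWith]

theorem isolated_sdiff (hadj : ∀ x y, adj x y → adj y x) (hJ : J ⊆ isolated adj X) :
    isolated adj (X \ J) = isolated adj X \ J := by
  ext x
  simp only [mem_isolated, mem_sdiff]
  refine ⟨fun ⟨⟨hx, hxJ⟩, h⟩ => ⟨⟨hx, fun y hy hxy => ?_⟩, hxJ⟩,
    fun ⟨⟨hx, h⟩, hxJ⟩ => ⟨⟨hx, hxJ⟩, fun y hy => h y hy.1⟩⟩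
  exact h y ⟨hy, fun hyJ => (mem_isolated.1 (hJ hyJ)).2 x hx (hadj _ _ hxy)⟩ hxy

theorem union_repair_mem_coveredWith (hadj : ∀ x y, adj x y → adj y x) (hZ : Z ⊆ W)
    (ha : a ∈ Z) (hb : b ∈ Z)
    (hM : M ∈ repairs adj W (nbrs adj W a ∪ nbrs adj W b) Z) :
    Z ∪ M ∈ coveredWith adj W a b := by
  obtain ⟨hMK, hM⟩ := mem_repairs.1 hM
  refine mem_coveredWith.2 ⟨union_subset hZ (hMK.trans (union_subset (filter_subset _ _)
    (filter_subset _ _))), ?_, mem_union_left _ ha, mem_union_left _ hb⟩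
  refine eq_empty_of_forall_notMem fun x hx => ?_
  obtain ⟨hx, h⟩ := mem_isolated.1 hx
  rcases mem_union.1 hx with hx | hx
  · obtain ⟨y, hy⟩ := hM x (mem_isolated.2 ⟨hx, fun y hy => h y (mem_union_left _ hy)⟩)
    simp only [mem_inter, mem_filter] at hy
    exact h y (mem_union_right _ hy.1) hy.2.2
  · rcases mem_union.1 (hMK hx) with h1 | h1
    · exact h a (mem_union_left _ ha) (hadj _ _ (mem_filter.1 h1).2)
    · exact h b (mem_union_left _ hb) (hadj _ _ (mem_filter.1 h1).2)

theorem disjoint_neighbors (ha : a ∈ isolated adj Z) (hb : b ∈ isolated adj Z) :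
    Disjoint Z (nbrs adj W a ∪ nbrs adj W b) := by
  refine disjoint_left.2 fun x hx h => ?_
  rcases mem_union.1 h with h | h
  · exact (mem_isolated.1 ha).2 x hx (mem_filter.1 h).2
  · exact (mem_isolated.1 hb).2 x hx (mem_filter.1 h).2

theorem eq_of_union_repair_eq {Z' M' : Finset α} (hZ : Disjoint Z K) (hZ' : Disjoint Z' K)
    (hM : M ⊆ K) (hM' : M' ⊆ K) (h : Z ∪ M = Z' ∪ M') : Z = Z' ∧ M = M' := by
  constructor
  · have := congrArg (· \ K) h
    simpa [union_sdiff_distrib, sdiff_eq_empty_iff_subset.2 hM, sdiff_eq_empty_iff_subset.2 hM',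
      sdiff_eq_self_of_disjoint hZ, sdiff_eq_self_of_disjoint hZ'] using this
  · have := congrArg (· ∩ K) h
    simpa [union_inter_distrib_right, inter_eq_left.2 hM, inter_eq_left.2 hM',
      disjoint_iff_inter_eq_empty.1 hZ, disjoint_iff_inter_eq_empty.1 hZ'] using this

theorem sum_card_repairs_le (hadj : ∀ x y, adj x y → adj y x) (𝒵 : Finset (Finset α))
    (h𝒵 : ∀ Z ∈ 𝒵, Z ⊆ W ∧ a ∈ isolated adj Z ∧ b ∈ isolated adj Z) :
    ∑ Z ∈ 𝒵, #(repairs adj W (nbrs adj W a ∪ nbrs adj W b) Z) ≤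
      #(coveredWith adj W a b) := by
  rw [← card_sigma]
  refine card_le_card_of_injOn (fun x => x.1 ∪ x.2) ?_ ?_
  · rintro ⟨Z, M⟩ h
    obtain ⟨hZ, hM⟩ := mem_sigma.1 h
    obtain ⟨h1, h2, h3⟩ := h𝒵 Z hZ
    exact union_repair_mem_coveredWith hadj h1 (isolated_subset _ h2) (isolated_subset _ h3) hM
  · rintro ⟨Z, M⟩ h ⟨Z', M'⟩ h' heq
    obtain ⟨hZ, hM⟩ := mem_sigma.1 h
    obtain ⟨hZ', hM'⟩ := mem_sigma.1 h'
    obtain ⟨-, h2, h3⟩ := h𝒵 Z hZ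
    obtain ⟨-, h2', h3'⟩ := h𝒵 Z' hZ'
    obtain ⟨rfl, rfl⟩ := eq_of_union_repair_eq (disjoint_neighbors h2 h3)
      (disjoint_neighbors h2' h3') (mem_repairs.1 hM).1 (mem_repairs.1 hM').1 heq
    rfl

theorem card_repairs_ge (hab : a ≠ b) (ha : a ∈ isolated adj Z) (hb : b ∈ isolated adj Z)
    (hnear : ∀ y ∈ isolated adj Z, ¬Disjoint (nbrs adj W a) (nbrs adj W y) ∨
      ¬Disjoint (nbrs adj W b) (nbrs adj W y)) :
    (2 : ℝ) ^ #(nbrs adj W a ∪ nbrs adj W b) *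
        ((1 - (1 / 2) ^ #(nbrs adj W a)) * (1 - (1 / 2) ^ #(nbrs adj W b))) *
        (1 / 2) ^ #(((isolated adj Z).erase a).erase b) ≤
      #(repairs adj W (nbrs adj W a ∪ nbrs adj W b) Z) := by
  set K := nbrs adj W a ∪ nbrs adj W b with hK
  have hinter : ∀ M ∈ K.powerset, ∀ y, M ∩ (nbrs adj W y ∩ K) = M ∩ nbrs adj W y := by
    intro M hM y
    rw [inter_comm _ K, ← inter_assoc, inter_eq_left.2 (mem_powerset.1 hM)]
  have h := card_hitting_ge (isolated adj Z) (fun y => nbrs adj W y ∩ K) K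
    (fun _ _ => inter_subset_right)
  have h1 : {M ∈ K.powerset | ∀ y ∈ isolated adj Z, (M ∩ (nbrs adj W y ∩ K)).Nonempty} =
      repairs adj W K Z := by
    refine filter_congr fun M hM => ?_
    simp only [hinter M hM]
  rw [h1] at h
  refine le_trans ?_ h
  rw [← mul_prod_erase _ _ ha, ← mul_prod_erase _ _ (mem_erase.2 ⟨hab.symm, hb⟩), mul_assoc,
    inter_eq_left.2 (subset_union_left : _ ⊆ K), inter_eq_left.2 (subset_union_right : _ ⊆ K)]
  rw [← mul_assoc (1 - (1 / 2 : ℝ) ^ _)]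
  have nn : ∀ n : ℕ, (0 : ℝ) ≤ 1 - (1 / 2) ^ n := fun n =>
    sub_nonneg.2 (pow_le_one₀ (by norm_num) (by norm_num))
  refine mul_le_mul_of_nonneg_left (mul_le_mul_of_nonneg_left ?_ (mul_nonneg (nn _) (nn _)))
    (by positivity)
  rw [← prod_const]
  refine prod_le_prod (fun _ _ => by norm_num) fun y hy => ?_
  have hpos : 1 ≤ #(nbrs adj W y ∩ K) := by
    rw [Nat.one_le_iff_ne_zero, Ne, card_eq_zero, ← disjoint_iff_inter_eq_empty, hK,
      disjoint_union_right]
    rintro ⟨h1, h2⟩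
    rcases hnear y (mem_of_mem_erase (mem_of_mem_erase hy)) with h | h
    · exact h h1.symm
    · exact h h2.symm
  have : (1 / 2 : ℝ) ^ #(nbrs adj W y ∩ K) ≤ (1 / 2) ^ 1 :=
    pow_le_pow_of_le_one (by norm_num) (by norm_num) hpos
  linarith

end Repairs

section NearPair
variable {α : Type*} [DecidableEq α] (adj : α → α → Prop) [DecidableRel adj]

/-- All isolated points of `Z` in `P` share neighbours in `W` with those in `Q`. -/
def IsNear (W P Q Z : Finset α) : Prop :=
  ∀ s ∈ isolated adj Z ∩ P, ∀ t ∈ isolated adj Z ∩ Q, ¬Disjoint (nbrs adj W s) (nbrs adj W t)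

instance (W P Q : Finset α) : DecidablePred (IsNear adj W P Q) := fun _ =>
  inferInstanceAs (Decidable (∀ s ∈ _, ∀ t ∈ _, ¬Disjoint _ _))

/-- The weight `1 / (|S| |T|)`, where `S` and `T` are the sets of isolated points in `P` and `Q`. -/
noncomputable def pairWeight (P Q Z : Finset α) : ℝ :=
  1 / #(isolated adj Z ∩ P) * (1 / #(isolated adj Z ∩ Q))

/-- The near sets whose isolated points lie in `P ∪ Q` and include `a` and `b`. -/
def nearSets (W P Q : Finset α) (a b : α) : Finset (Finset α) :=
  {Z ∈ W.powerset | isolated adj Z ⊆ P ∪ Q ∧ a ∈ isolated adj Z ∧ b ∈ isolated adj Z ∧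
    IsNear adj W P Q Z}

variable {adj} {W P Q C X Y Z K M J R : Finset α} {a b x y : α}

theorem pairWeight_nonneg : 0 ≤ pairWeight adj P Q Z := by unfold pairWeight; positivity

theorem mem_nearSets : Z ∈ nearSets adj W P Q a b ↔ Z ⊆ W ∧ isolated adj Z ⊆ P ∪ Q ∧
    a ∈ isolated adj Z ∧ b ∈ isolated adj Z ∧ IsNear adj W P Q Z := by
  simp [nearSets]

theorem sum_pairWeight_le_of_subset_union (hadj : ∀ x y, adj x y → adj y x)
    (hPC : Disjoint P C) (hQC : Disjoint Q C) (ha : a ∈ P) (hb : b ∈ Q) (𝒳 : Finset (Finset α))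
    (h𝒳 : ∀ X ∈ 𝒳, X ⊆ W ∧ isolated adj X ⊆ P ∪ Q ∪ C ∧ a ∈ isolated adj X ∧
      b ∈ isolated adj X ∧ IsNear adj W P Q X) :
    ∑ X ∈ 𝒳, pairWeight adj P Q X ≤
      2 ^ #C * ∑ Z ∈ nearSets adj W P Q a b, pairWeight adj P Q Z := by
  have hiso : ∀ X, isolated adj (X \ (isolated adj X ∩ C)) = isolated adj X \ C := fun X => by
    rw [isolated_sdiff hadj inter_subset_left, sdiff_inter_self_left]
  have hP : ∀ X, isolated adj X \ C ∩ P = isolated adj X ∩ P := fun X => by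
    rw [sdiff_inter_right_comm, inter_sdiff_assoc, sdiff_eq_self_of_disjoint hPC]
  have hQ : ∀ X, isolated adj X \ C ∩ Q = isolated adj X ∩ Q := fun X => by
    rw [sdiff_inter_right_comm, inter_sdiff_assoc, sdiff_eq_self_of_disjoint hQC]
  have h1 : 2 ^ #C * ∑ Z ∈ nearSets adj W P Q a b, pairWeight adj P Q Z =
      ∑ x ∈ nearSets adj W P Q a b ×ˢ C.powerset, pairWeight adj P Q x.1 := by
    rw [sum_product, mul_sum]
    simp
  rw [h1]
  have hinj : Set.InjOn (fun X => (X \ (isolated adj X ∩ C), isolated adj X ∩ C))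
      (𝒳 : Set (Finset α)) := by
    intro X _ X' _ h
    simp only [Prod.mk.injEq] at h
    rw [← sdiff_union_of_subset (inter_subset_left.trans (isolated_subset X) :
      isolated adj X ∩ C ⊆ X), h.1, h.2, sdiff_union_of_subset
      (inter_subset_left.trans (isolated_subset X'))]
  calc ∑ X ∈ 𝒳, pairWeight adj P Q X
      = ∑ x ∈ 𝒳.image fun X => (X \ (isolated adj X ∩ C), isolated adj X ∩ C),
          pairWeight adj P Q x.1 := by
        rw [sum_image hinj]
        refine sum_congr rfl fun X _ => ?_
        simp only [pairWeight, hiso, hP, hQ]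
    _ ≤ _ := by
        refine sum_le_sum_of_subset_of_nonneg ?_ fun _ _ _ => pairWeight_nonneg
        refine image_subset_iff.2 fun X hX => mem_product.2 ⟨mem_nearSets.2 ?_,
          mem_powerset.2 inter_subset_right⟩
        obtain ⟨hXW, hXi, hXa, hXb, hn⟩ := h𝒳 X hX
        rw [hiso]
        refine ⟨sdiff_subset.trans hXW, ?_, mem_sdiff.2 ⟨hXa, disjoint_left.1 hPC ha⟩,
          mem_sdiff.2 ⟨hXb, disjoint_left.1 hQC hb⟩, ?_⟩
        · exact sdiff_le_iff'.2 hXi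
        · unfold IsNear
          rw [hiso, hP, hQ]
          exact hn

theorem sum_nearSets_fiber (hadj : ∀ x y, adj x y → adj y x) (hPQ : Disjoint P Q) (ha : a ∈ P)
    (hb : b ∈ Q) (R : Finset α) :
    (∑ Z ∈ nearSets adj W P Q a b with Z \ isolated adj Z = R, pairWeight adj P Q Z) *
        (3 / 2) ^ (#(P.erase a) + #(Q.erase b)) ≤
      (∑ Z ∈ nearSets adj W P Q a b with Z \ isolated adj Z = R,
        (1 / 2 : ℝ) ^ #(((isolated adj Z).erase a).erase b)) *
        ((2 ^ (#(P.erase a) + 1) - 1) / (#(P.erase a) + 1) *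
          ((2 ^ (#(Q.erase b) + 1) - 1) / (#(Q.erase b) + 1))) := by
  classical
  have hab : a ≠ b := fun h => disjoint_left.1 hPQ ha (h ▸ hb)
  have haQ : a ∉ Q := disjoint_left.1 hPQ ha
  have hbP : b ∉ P := disjoint_right.1 hPQ hb
  have hPQ' : Disjoint (P.erase a) (Q.erase b) :=
    hPQ.mono (erase_subset _ _) (erase_subset _ _)
  obtain ⟨e, he⟩ : ∃ e : Finset α → Finset α, ∀ J, e J = insert a (insert b J) :=
    ⟨_, fun _ => rfl⟩
  obtain ⟨I, hIe⟩ : ∃ I : Finset α → Prop, ∀ J, I J ↔ Disjoint R (e J) ∧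
      R ∪ e J ∈ nearSets adj W P Q a b ∧ isolated adj (R ∪ e J) = e J := ⟨_, fun _ => Iff.rfl⟩
  have hnotMem : ∀ J ∈ (P.erase a ∪ Q.erase b).powerset, a ∉ J ∧ b ∉ J := by
    refine fun J hJ => ⟨fun h => ?_, fun h => ?_⟩
    · simpa [haQ] using mem_powerset.1 hJ h
    · simpa [hbP] using mem_powerset.1 hJ h
  have hI : ∀ ⦃s t⦄, s ⊆ t → t ⊆ P.erase a ∪ Q.erase b → I t → I s := by
    intro s t hst ht hIt
    obtain ⟨h1, h2, h3⟩ := (hIe t).1 hIt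
    have hest : e s ⊆ e t := by
      rw [he, he]
      exact insert_subset_insert _ (insert_subset_insert _ hst)
    have hes : Disjoint R (e s) := h1.mono_right hest
    have h4 : R ∪ e s = (R ∪ e t) \ (e t \ e s) := by
      rw [union_sdiff_distrib, Finset.sdiff_sdiff_eq_self hest,
        sdiff_eq_self_of_disjoint (h1.mono_right sdiff_subset)]
    have h5 : isolated adj (R ∪ e s) = e s := by
      rw [h4, isolated_sdiff hadj (by rw [h3]; exact sdiff_subset), h3,
        Finset.sdiff_sdiff_eq_self hest]
    obtain ⟨k1, k2, k3, k4, k5⟩ := mem_nearSets.1 h2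
    refine (hIe s).2 ⟨hes,
      mem_nearSets.2 ⟨(union_subset_union_right hest).trans k1, ?_, ?_, ?_, ?_⟩, h5⟩
    · rw [h5]
      exact hest.trans (h3 ▸ k2)
    · rw [h5, he]
      simp
    · rw [h5, he]
      simp
    · rw [IsNear, h5]
      rw [IsNear, h3] at k5
      exact fun x hx y hy => k5 x (inter_subset_inter_right hest hx) y
        (inter_subset_inter_right hest hy)
  have hreindex : ∀ f : Finset α → ℝ,
      ∑ Z ∈ nearSets adj W P Q a b with Z \ isolated adj Z = R, f Z =
        ∑ J ∈ (P.erase a ∪ Q.erase b).powerset with I J, f (R ∪ e J) := by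
    intro f
    have hback : ∀ Z ∈ nearSets adj W P Q a b, e (((isolated adj Z).erase a).erase b) =
        isolated adj Z := by
      intro Z hZ
      obtain ⟨-, -, k3, k4, -⟩ := mem_nearSets.1 hZ
      rw [he, insert_erase (mem_erase.2 ⟨hab.symm, k4⟩), insert_erase k3]
    refine sum_bij' (fun Z _ => ((isolated adj Z).erase a).erase b) (fun J _ => R ∪ e J)
      ?_ ?_ ?_ ?_ ?_
    · intro Z hZ
      obtain ⟨hZ, hZR⟩ := mem_filter.1 hZ
      have hZ' : Z \ isolated adj Z ∪ isolated adj Z = Z :=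
        sdiff_union_of_subset (isolated_subset Z)
      obtain ⟨k1, k2, k3, k4, k5⟩ := mem_nearSets.1 hZ
      refine mem_filter.2 ⟨mem_powerset.2 fun x hx => ?_, ?_⟩
      · simp only [mem_erase] at hx
        have := k2 hx.2.2
        simp only [mem_union, mem_erase] at this ⊢
        tauto
      · rw [hIe, ← hZR, hback Z hZ, hZ']
        exact ⟨sdiff_disjoint, hZ, rfl⟩
    · intro J hJ
      obtain ⟨h1, h2, h3⟩ := (hIe J).1 (mem_filter.1 hJ).2
      refine mem_filter.2 ⟨h2, ?_⟩
      rw [h3, union_sdiff_cancel_right h1]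
    · intro Z hZ
      obtain ⟨hZ, hZR⟩ := mem_filter.1 hZ
      rw [← hZR, hback Z hZ, sdiff_union_of_subset (isolated_subset Z)]
    · intro J hJ
      obtain ⟨-, -, h3⟩ := (hIe J).1 (mem_filter.1 hJ).2
      obtain ⟨h1, h2⟩ := hnotMem J (mem_filter.1 hJ).1
      rw [h3, he, erase_insert (by simp [hab, h1]), erase_insert h2]
    · intro Z hZ
      obtain ⟨hZ, hZR⟩ := mem_filter.1 hZ
      rw [← hZR, hback Z hZ, sdiff_union_of_subset (isolated_subset Z)]
  have h := sum_complex_le hPQ' I hI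
  rw [hreindex, hreindex]
  convert h using 2
  · refine sum_congr rfl fun J hJ => ?_
    obtain ⟨-, -, h3⟩ := (hIe J).1 (mem_filter.1 hJ).2
    obtain ⟨h1, h2⟩ := hnotMem J (mem_filter.1 hJ).1
    have h4 : e J ∩ P = insert a (J ∩ P.erase a) := by
      rw [he, insert_inter_of_mem ha, insert_inter_of_notMem hbP, inter_erase,
        erase_eq_of_notMem fun h => h1 (mem_of_mem_inter_left h)]
    have h5 : e J ∩ Q = insert b (J ∩ Q.erase b) := by
      rw [he, insert_inter_of_notMem haQ, insert_inter_of_mem hb, inter_erase,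
        erase_eq_of_notMem fun h => h2 (mem_of_mem_inter_left h)]
    rw [pairWeight, h3, h4, h5, card_insert_of_notMem (by simp), card_insert_of_notMem (by simp)]
    push_cast
    rfl
  · refine sum_congr rfl fun J hJ => ?_
    obtain ⟨-, -, h3⟩ := (hIe J).1 (mem_filter.1 hJ).2
    obtain ⟨h1, h2⟩ := hnotMem J (mem_filter.1 hJ).1
    rw [h3, he, erase_insert (by simp [hab, h1]), erase_insert h2]

theorem sum_pairWeight_near_le (hadj : ∀ x y, adj x y → adj y x) (hPQ : Disjoint P Q)
    (hPC : Disjoint P C) (hQC : Disjoint Q C) (ha : a ∈ P) (hb : b ∈ Q)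
    (hda : #Q + #C ≤ #(nbrs adj W a)) (hdb : #P + #C ≤ #(nbrs adj W b)) (𝒳 : Finset (Finset α))
    (h𝒳 : ∀ X ∈ 𝒳, X ⊆ W ∧ isolated adj X ⊆ P ∪ Q ∪ C ∧ a ∈ isolated adj X ∧
      b ∈ isolated adj X ∧ IsNear adj W P Q X) :
    (∑ X ∈ 𝒳, pairWeight adj P Q X) * (#P * #Q) ≤ 2 * #(coveredWith adj W a b) := by
  have hab : a ≠ b := fun h => disjoint_left.1 hPQ ha (h ▸ hb)
  set p := #(P.erase a) with hp
  set q := #(Q.erase b) with hq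
  have hP : #P = p + 1 := (card_erase_add_one ha).symm
  have hQ : #Q = q + 1 := (card_erase_add_one hb).symm
  set φ := ∑ Z ∈ nearSets adj W P Q a b, pairWeight adj P Q Z
  set ψ := ∑ Z ∈ nearSets adj W P Q a b, (1 / 2 : ℝ) ^ #(((isolated adj Z).erase a).erase b)
  set H : ℝ := 2 ^ #(nbrs adj W a ∪ nbrs adj W b) *
    ((1 - (1 / 2) ^ #(nbrs adj W a)) * (1 - (1 / 2) ^ #(nbrs adj W b))) with hH
  have hφψ : φ * (3 / 2) ^ (p + q) ≤
      ψ * ((2 ^ (p + 1) - 1) / (p + 1) * ((2 ^ (q + 1) - 1) / (q + 1))) := by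
    have hmaps : ∀ Z ∈ nearSets adj W P Q a b, Z \ isolated adj Z ∈ W.powerset := fun Z hZ =>
      mem_powerset.2 (sdiff_subset.trans (mem_nearSets.1 hZ).1)
    simp only [φ, ψ]
    rw [← sum_fiberwise_of_maps_to hmaps (pairWeight adj P Q), ← sum_fiberwise_of_maps_to hmaps
      (fun Z => (1 / 2 : ℝ) ^ #(((isolated adj Z).erase a).erase b)), sum_mul, sum_mul]
    exact sum_le_sum fun R _ => sum_nearSets_fiber hadj hPQ ha hb R
  have hψ : ψ * H ≤ #(coveredWith adj W a b) := by
    have h1 := sum_card_repairs_le (W := W) hadj (nearSets adj W P Q a b) fun Z hZ =>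
      have h := mem_nearSets.1 hZ
      ⟨h.1, h.2.2.1, h.2.2.2.1⟩
    refine le_trans ?_ (Nat.cast_le.2 h1)
    push_cast
    rw [sum_mul]
    refine sum_le_sum fun Z hZ => ?_
    obtain ⟨-, k2, k3, k4, k5⟩ := mem_nearSets.1 hZ
    rw [mul_comm]
    refine card_repairs_ge hab k3 k4 fun y hy => ?_
    rcases mem_union.1 (k2 hy) with h | h
    · exact Or.inr fun hd => k5 y (mem_inter.2 ⟨hy, h⟩) b (mem_inter.2 ⟨k4, hb⟩) hd.symm
    · exact Or.inl (k5 a (mem_inter.2 ⟨k3, ha⟩) y (mem_inter.2 ⟨hy, h⟩))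
  have hH0 : 0 < H := by
    have : ∀ n : ℕ, 0 < n → (0 : ℝ) < 1 - (1 / 2) ^ n := fun n hn =>
      sub_pos.2 (pow_lt_one₀ (by norm_num) (by norm_num) hn.ne')
    exact mul_pos (by positivity) (mul_pos (this _ (by omega)) (this _ (by omega)))
  have hbound := near_pair_bound (p := p) (q := q) (c := #C) (k := #(nbrs adj W a ∪ nbrs adj W b))
    (hQ ▸ hda) (hP ▸ hdb) (card_le_card subset_union_left) (card_le_card subset_union_right)
  rw [← hH] at hbound
  have hstart := sum_pairWeight_le_of_subset_union hadj hPC hQC ha hb 𝒳 h𝒳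
  have hψ0 : 0 ≤ ψ := sum_nonneg fun _ _ => by positivity
  have hmain : φ * (3 / 2) ^ (p + q) * ((p + 1) * (q + 1)) ≤
      ψ * ((2 ^ (p + 1) - 1) * (2 ^ (q + 1) - 1)) := by
    refine (mul_le_mul_of_nonneg_right hφψ (by positivity)).trans_eq ?_
    field_simp
  have h3 : (0 : ℝ) < (3 / 2) ^ (p + q) := by positivity
  rw [hP, hQ]
  push_cast
  refine (mul_le_mul_of_nonneg_right hstart (by positivity)).trans ?_
  refine le_of_mul_le_mul_right ?_ h3
  calc 2 ^ #C * φ * ((p + 1) * (q + 1)) * (3 / 2) ^ (p + q)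
      = 2 ^ #C * (φ * (3 / 2) ^ (p + q) * ((p + 1) * (q + 1))) := by ring
    _ ≤ 2 ^ #C * (ψ * ((2 ^ (p + 1) - 1) * (2 ^ (q + 1) - 1))) := by gcongr
    _ = ψ * (2 ^ #C * ((2 ^ (p + 1) - 1) * (2 ^ (q + 1) - 1))) := by ring
    _ ≤ ψ * (2 * (3 / 2) ^ (p + q) * H) := by gcongr
    _ = 2 * (3 / 2) ^ (p + q) * (ψ * H) := by ring
    _ ≤ 2 * (3 / 2) ^ (p + q) * #(coveredWith adj W a b) := by gcongr
    _ = _ := by ring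

end NearPair

section Main
variable {α : Type*} [DecidableEq α] {adj : α → α → Prop} [DecidableRel adj]
  {W P Q C : Finset α} {a b : α}

theorem two_mul_le_two_pow (n : ℕ) : (2 : ℝ) * n ≤ 2 ^ n := by
  cases n with
  | zero => simp
  | succ n =>
    have : n + 1 ≤ 2 ^ n := Nat.lt_two_pow_self
    have : (n + 1 : ℝ) ≤ 2 ^ n := by exact_mod_cast this
    rw [pow_succ]
    push_cast
    linarith

theorem card_far_le (hadj : ∀ x y, adj x y → adj y x) (hPQ : Disjoint P Q) (ha : a ∈ P)
    (hb : b ∈ Q) (hda : #Q + #C ≤ #(nbrs adj W a)) (hdb : #P + #C ≤ #(nbrs adj W b))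
    (hfar : Disjoint (nbrs adj W a) (nbrs adj W b)) (𝒳 : Finset (Finset α))
    (h𝒳 : ∀ X ∈ 𝒳, X ⊆ W ∧ isolated adj X ⊆ P ∪ Q ∪ C ∧ a ∈ isolated adj X ∧
      b ∈ isolated adj X) :
    (#𝒳 : ℝ) ≤ ∑ Y ∈ coveredWith adj W a b, 1 / (#(Y ∩ P) : ℝ) * (1 / #(Y ∩ Q)) := by
  have hab : a ≠ b := fun h => disjoint_left.1 hPQ ha (h ▸ hb)
  have hp : 0 < #P := card_pos.2 ⟨a, ha⟩
  have hq : 0 < #Q := card_pos.2 ⟨b, hb⟩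
  set K := nbrs adj W a ∪ nbrs adj W b with hK
  have hKcard : #K = #(nbrs adj W a) + #(nbrs adj W b) := card_union_of_disjoint hfar
  obtain ⟨D, hD⟩ : ∃ D : Finset α → Finset α, ∀ X, D X = ((isolated adj X).erase a).erase b :=
    ⟨_, fun _ => rfl⟩
  have hDi : ∀ X, D X ⊆ isolated adj X := fun X => by
    rw [hD]; exact (erase_subset _ _).trans (erase_subset _ _)
  have hDX : ∀ X, D X ⊆ X := fun X => (hDi X).trans (isolated_subset X)
  have hiso : ∀ X ∈ 𝒳, isolated adj (X \ D X) = {a, b} := by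
    intro X hX
    obtain ⟨-, -, h3, h4⟩ := h𝒳 X hX
    rw [isolated_sdiff hadj (hDi X), hD]
    ext x
    simp only [mem_sdiff, mem_erase, mem_insert, mem_singleton]
    constructor
    · tauto
    · rintro (rfl | rfl) <;> simp [*]
  have hrep : ∀ X ∈ 𝒳, (2 : ℝ) ^ #K / 4 ≤ #(repairs adj W K (X \ D X)) := by
    intro X hX
    have hi := hiso X hX
    have half : ∀ n : ℕ, 1 ≤ n → (1 / 2 : ℝ) ≤ 1 - (1 / 2) ^ n := fun n hn => by
      have : (1 / 2 : ℝ) ^ n ≤ (1 / 2) ^ 1 :=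
        pow_le_pow_of_le_one (by norm_num) (by norm_num) hn
      linarith
    have hself : ∀ y, 0 < #(nbrs adj W y) → ¬Disjoint (nbrs adj W y) (nbrs adj W y) := by
      intro y hy h
      rw [disjoint_self, bot_eq_empty] at h
      simp [h] at hy
    have h := card_repairs_ge (adj := adj) (W := W) (Z := X \ D X) hab (by simp [hi])
      (by simp [hi]) (by
        intro y hy
        simp only [hi, mem_insert, mem_singleton] at hy
        rcases hy with rfl | rfl
        · exact Or.inl (hself _ (by omega))
        · exact Or.inr (hself _ (by omega)))
    have he : ((isolated adj (X \ D X)).erase a).erase b = ∅ := by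
      rw [hi]; ext x; simp; tauto
    rw [he, card_empty, pow_zero, mul_one] at h
    refine le_trans ?_ h
    rw [div_eq_mul_inv]
    refine mul_le_mul_of_nonneg_left ?_ (by positivity)
    calc (4 : ℝ)⁻¹ = 1 / 2 * (1 / 2) := by norm_num
      _ ≤ _ := mul_le_mul (half _ (by omega)) (half _ (by omega)) (by norm_num)
        (le_trans (by norm_num) (half _ (by omega : 1 ≤ #(nbrs adj W a))))
  have hmaps : ∀ x ∈ 𝒳.sigma fun X => repairs adj W K (X \ D X),
      (x.1 \ D x.1) ∪ x.2 ∈ coveredWith adj W a b := by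
    rintro ⟨X, M⟩ h
    obtain ⟨hX, hM⟩ := mem_sigma.1 h
    refine union_repair_mem_coveredWith hadj (sdiff_subset.trans (h𝒳 X hX).1)
      (isolated_subset (adj := adj) _ ?_)
      (isolated_subset (adj := adj) _ ?_) hM <;> simp [hiso X hX]
  have hfib : ∀ Y ∈ coveredWith adj W a b,
      (#{x ∈ 𝒳.sigma fun X => repairs adj W K (X \ D X) | (x.1 \ D x.1) ∪ x.2 = Y} : ℝ) ≤
        2 ^ #K / 4 * (1 / (#(Y ∩ P) : ℝ) * (1 / #(Y ∩ Q))) := by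
    intro Y hY
    obtain ⟨-, -, haY, hbY⟩ := mem_coveredWith.1 hY
    have h1 : #{x ∈ 𝒳.sigma fun X => repairs adj W K (X \ D X) | (x.1 \ D x.1) ∪ x.2 = Y} ≤
        #((P ∪ Q ∪ C) \ Y).powerset := by
      refine card_le_card_of_injOn (fun x => D x.1) ?_ ?_
      · rintro ⟨X, M⟩ h
        obtain ⟨hXM, rfl⟩ := mem_filter.1 h
        obtain ⟨hX, hM⟩ := mem_sigma.1 hXM
        obtain ⟨-, h2, h3, h4⟩ := h𝒳 X hX
        refine mem_powerset.2 (subset_sdiff.2 ⟨(hDi X).trans h2, ?_⟩)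
        exact disjoint_union_right.2 ⟨disjoint_sdiff,
          (disjoint_neighbors h3 h4).mono (hDX X) (mem_repairs.1 hM).1⟩
      · rintro ⟨X, M⟩ h ⟨X', M'⟩ h' hDD
        obtain ⟨hXM, hY⟩ := mem_filter.1 h
        obtain ⟨hXM', hY'⟩ := mem_filter.1 h'
        obtain ⟨hX, hM⟩ := mem_sigma.1 hXM
        obtain ⟨hX', hM'⟩ := mem_sigma.1 hXM'
        obtain ⟨-, -, h3, h4⟩ := h𝒳 X hX
        obtain ⟨-, -, h3', h4'⟩ := h𝒳 X' hX'
        obtain ⟨e1, e2⟩ := eq_of_union_repair_eq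
          ((disjoint_neighbors h3 h4).mono_left sdiff_subset)
          ((disjoint_neighbors h3' h4').mono_left sdiff_subset)
          (mem_repairs.1 hM).1 (mem_repairs.1 hM').1 (hY.trans hY'.symm)
        dsimp only at hDD e1 e2
        have : X = X' := by
          rw [← sdiff_union_of_subset (hDX X), e1, hDD, sdiff_union_of_subset (hDX X')]
        subst this e2
        rfl
    have h2 : #((P ∪ Q ∪ C) \ Y) + (#(Y ∩ P) + #(Y ∩ Q)) ≤ #K := by
      have e1 := card_sdiff_add_card_inter P Y
      have e2 := card_sdiff_add_card_inter Q Y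
      have e3 : #((P ∪ Q ∪ C) \ Y) ≤ #(P \ Y) + #(Q \ Y) + #C := by
        rw [union_sdiff_distrib, union_sdiff_distrib]
        exact (card_union_le _ _).trans
          (add_le_add (card_union_le _ _) (card_le_card sdiff_subset))
      rw [inter_comm Y P, inter_comm Y Q]
      omega
    rw [card_powerset] at h1
    have hyP : (0 : ℝ) < #(Y ∩ P) := Nat.cast_pos.2 (card_pos.2 ⟨a, mem_inter.2 ⟨haY, ha⟩⟩)
    have hyQ : (0 : ℝ) < #(Y ∩ Q) := Nat.cast_pos.2 (card_pos.2 ⟨b, mem_inter.2 ⟨hbY, hb⟩⟩)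
    refine (show _ ≤ ((2 : ℝ) ^ #((P ∪ Q ∪ C) \ Y)) by exact_mod_cast h1).trans ?_
    rw [one_div_mul_one_div, mul_one_div, div_div, le_div_iff₀ (by positivity)]
    calc (2 : ℝ) ^ #((P ∪ Q ∪ C) \ Y) * (4 * (#(Y ∩ P) * #(Y ∩ Q)))
        = 2 ^ #((P ∪ Q ∪ C) \ Y) * ((2 * #(Y ∩ P)) * (2 * #(Y ∩ Q))) := by ring
      _ ≤ 2 ^ #((P ∪ Q ∪ C) \ Y) * (2 ^ #(Y ∩ P) * 2 ^ #(Y ∩ Q)) := by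
        gcongr <;> exact two_mul_le_two_pow _
      _ = 2 ^ (#((P ∪ Q ∪ C) \ Y) + (#(Y ∩ P) + #(Y ∩ Q))) := by rw [pow_add, pow_add]
      _ ≤ 2 ^ #K := pow_le_pow_right₀ (by norm_num) h2
  have hcount := card_eq_sum_card_fiberwise hmaps
  rw [card_sigma] at hcount
  have hpos : (0 : ℝ) < 2 ^ #K / 4 := by positivity
  refine le_of_mul_le_mul_left ?_ hpos
  calc (2 : ℝ) ^ #K / 4 * #𝒳 = ∑ X ∈ 𝒳, (2 : ℝ) ^ #K / 4 := by
        rw [sum_const, nsmul_eq_mul, mul_comm]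
    _ ≤ ∑ X ∈ 𝒳, (#(repairs adj W K (X \ D X)) : ℝ) := sum_le_sum hrep
    _ = ∑ Y ∈ coveredWith adj W a b,
        (#{x ∈ 𝒳.sigma fun X => repairs adj W K (X \ D X) | (x.1 \ D x.1) ∪ x.2 = Y} : ℝ) := by
      exact_mod_cast hcount
    _ ≤ ∑ Y ∈ coveredWith adj W a b, 2 ^ #K / 4 * (1 / (#(Y ∩ P) : ℝ) * (1 / #(Y ∩ Q))) :=
      sum_le_sum hfib
    _ = _ := by rw [mul_sum]

theorem sum_pairs_inv_card (𝒳 : Finset (Finset α)) (S : Finset α → Finset α)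
    (hS : ∀ X ∈ 𝒳, (S X ∩ P).Nonempty ∧ (S X ∩ Q).Nonempty) :
    ∑ x ∈ P ×ˢ Q, ∑ X ∈ 𝒳 with x.1 ∈ S X ∧ x.2 ∈ S X,
      1 / (#(S X ∩ P) : ℝ) * (1 / #(S X ∩ Q)) = #𝒳 := by
  simp only [sum_filter]
  rw [sum_comm, card_eq_sum_ones, Nat.cast_sum]
  refine sum_congr rfl fun X hX => ?_
  have h : {x ∈ P ×ˢ Q | x.1 ∈ S X ∧ x.2 ∈ S X} = (S X ∩ P) ×ˢ (S X ∩ Q) := by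
    ext x
    simp only [mem_filter, mem_product, mem_inter]
    tauto
  have h1 : (#(S X ∩ P) : ℝ) ≠ 0 := Nat.cast_ne_zero.2 (card_pos.2 (hS X hX).1).ne'
  have h2 : (#(S X ∩ Q) : ℝ) ≠ 0 := Nat.cast_ne_zero.2 (card_pos.2 (hS X hX).2).ne'
  rw [← sum_filter, h, sum_const, card_product, nsmul_eq_mul]
  push_cast
  field_simp

theorem card_isolated_le_two_mul (hadj : ∀ x y, adj x y → adj y x) (hPQ : Disjoint P Q)
    (hPC : Disjoint P C) (hQC : Disjoint Q C)
    (hdP : ∀ a ∈ P, ¬adj a a → #Q + #C ≤ #(nbrs adj W a))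
    (hdQ : ∀ b ∈ Q, ¬adj b b → #P + #C ≤ #(nbrs adj W b)) (𝒳 : Finset (Finset α))
    (h𝒳 : ∀ X ∈ 𝒳, X ⊆ W ∧ isolated adj X ⊆ P ∪ Q ∪ C ∧ (isolated adj X ∩ P).Nonempty ∧
      (isolated adj X ∩ Q).Nonempty) :
    #𝒳 ≤ 2 * #{Y ∈ W.powerset | isolated adj Y = ∅ ∧ (Y ∩ P).Nonempty ∧ (Y ∩ Q).Nonempty} := by
  set 𝒴 := {Y ∈ W.powerset | isolated adj Y = ∅ ∧ (Y ∩ P).Nonempty ∧ (Y ∩ Q).Nonempty} with h𝒴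
  have hcov : ∀ a ∈ P, ∀ b ∈ Q, {Y ∈ 𝒴 | a ∈ Y ∧ b ∈ Y} = coveredWith adj W a b := by
    intro a ha b hb
    rw [h𝒴, filter_filter, coveredWith]
    refine filter_congr fun Y _ => ⟨fun h => ⟨h.1.1, h.2⟩, fun h => ⟨⟨h.1, ?_, ?_⟩, h.2⟩⟩
    · exact ⟨a, mem_inter.2 ⟨h.2.1, ha⟩⟩
    · exact ⟨b, mem_inter.2 ⟨h.2.2, hb⟩⟩
  set 𝒩 := {X ∈ 𝒳 | IsNear adj W P Q X}
  set 𝒟 := {X ∈ 𝒳 | ¬IsNear adj W P Q X}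
  have hpair : ∀ x ∈ P ×ˢ Q,
      ∑ X ∈ 𝒩 with x.1 ∈ isolated adj X ∧ x.2 ∈ isolated adj X, pairWeight adj P Q X +
        (#{X ∈ 𝒟 | (x.1 ∈ isolated adj X ∧ x.2 ∈ isolated adj X) ∧
          Disjoint (nbrs adj W x.1) (nbrs adj W x.2)} : ℝ) ≤
      2 * ∑ Y ∈ 𝒴 with x.1 ∈ Y ∧ x.2 ∈ Y, 1 / (#(Y ∩ P) : ℝ) * (1 / #(Y ∩ Q)) := by
    rintro ⟨a, b⟩ hx
    obtain ⟨ha, hb⟩ := mem_product.1 hx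
    dsimp only at ha hb ⊢
    rw [hcov a ha b hb]
    have hnn : 0 ≤ ∑ Y ∈ coveredWith adj W a b, 1 / (#(Y ∩ P) : ℝ) * (1 / #(Y ∩ Q)) :=
      sum_nonneg fun _ _ => by positivity
    by_cases hloop : adj a a ∨ adj b b
    · have hno : ∀ X, ¬(a ∈ isolated adj X ∧ b ∈ isolated adj X) := by
        rintro X ⟨h1, h2⟩
        rw [mem_isolated] at h1 h2
        exact hloop.elim (h1.2 a h1.1) (h2.2 b h2.1)
      simp only [hno, false_and, filter_false, sum_empty, card_empty, Nat.cast_zero, add_zero]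
      linarith
    rw [not_or] at hloop
    have hda := hdP a ha hloop.1
    have hdb := hdQ b hb hloop.2
    by_cases hd : Disjoint (nbrs adj W a) (nbrs adj W b)
    · have h1 : {X ∈ 𝒩 | a ∈ isolated adj X ∧ b ∈ isolated adj X} = ∅ := by
        refine filter_eq_empty_iff.2 fun X hX h => ?_
        exact (mem_filter.1 hX).2 a (mem_inter.2 ⟨h.1, ha⟩) b (mem_inter.2 ⟨h.2, hb⟩) hd
      have h2 := card_far_le hadj hPQ ha hb hda hdb hd
        {X ∈ 𝒟 | (a ∈ isolated adj X ∧ b ∈ isolated adj X) ∧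
          Disjoint (nbrs adj W a) (nbrs adj W b)} fun X hX => by
          obtain ⟨hX, h⟩ := mem_filter.1 hX
          obtain ⟨k1, k2, -⟩ := h𝒳 X (mem_filter.1 hX).1
          exact ⟨k1, k2, h.1⟩
      rw [h1, sum_empty, zero_add]
      linarith
    · simp only [hd, and_false, filter_false, card_empty, Nat.cast_zero, add_zero]
      have h1 := sum_pairWeight_near_le hadj hPQ hPC hQC ha hb hda hdb
        {X ∈ 𝒩 | a ∈ isolated adj X ∧ b ∈ isolated adj X} fun X hX => by
          obtain ⟨hX, h⟩ := mem_filter.1 hX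
          obtain ⟨hX, hn⟩ := mem_filter.1 hX
          obtain ⟨k1, k2, -⟩ := h𝒳 X hX
          exact ⟨k1, k2, h.1, h.2, hn⟩
      have hp : (0 : ℝ) < #P := Nat.cast_pos.2 (card_pos.2 ⟨a, ha⟩)
      have hq : (0 : ℝ) < #Q := Nat.cast_pos.2 (card_pos.2 ⟨b, hb⟩)
      refine le_of_mul_le_mul_right (h1.trans ?_) (mul_pos hp hq)
      rw [mul_assoc, sum_mul]
      refine mul_le_mul_of_nonneg_left ?_ zero_le_two
      rw [card_eq_sum_ones, Nat.cast_sum]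
      refine sum_le_sum fun Y hY => ?_
      obtain ⟨-, -, haY, hbY⟩ := mem_coveredWith.1 hY
      have hyP : (0 : ℝ) < #(Y ∩ P) := Nat.cast_pos.2 (card_pos.2 ⟨a, mem_inter.2 ⟨haY, ha⟩⟩)
      have hyQ : (0 : ℝ) < #(Y ∩ Q) := Nat.cast_pos.2 (card_pos.2 ⟨b, mem_inter.2 ⟨hbY, hb⟩⟩)
      have hleP : (#(Y ∩ P) : ℝ) ≤ #P := Nat.cast_le.2 (card_le_card inter_subset_right)
      have hleQ : (#(Y ∩ Q) : ℝ) ≤ #Q := Nat.cast_le.2 (card_le_card inter_subset_right)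
      rw [one_div_mul_one_div, one_div_mul_eq_div, Nat.cast_one, one_le_div (by positivity)]
      exact mul_le_mul hleP hleQ hyQ.le hp.le
  have hN : ∑ x ∈ P ×ˢ Q, ∑ X ∈ 𝒩 with x.1 ∈ isolated adj X ∧ x.2 ∈ isolated adj X,
      pairWeight adj P Q X = #𝒩 :=
    sum_pairs_inv_card 𝒩 (isolated adj) fun X hX => (h𝒳 X (mem_filter.1 hX).1).2.2
  have hY : ∑ x ∈ P ×ˢ Q, ∑ Y ∈ 𝒴 with x.1 ∈ Y ∧ x.2 ∈ Y,
      1 / (#(Y ∩ P) : ℝ) * (1 / #(Y ∩ Q)) = #𝒴 :=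
    sum_pairs_inv_card 𝒴 id fun X hX => (mem_filter.1 hX).2.2
  have hD : #𝒟 ≤ ∑ x ∈ P ×ˢ Q, #{X ∈ 𝒟 | (x.1 ∈ isolated adj X ∧ x.2 ∈ isolated adj X) ∧
      Disjoint (nbrs adj W x.1) (nbrs adj W x.2)} := by
    refine le_trans (card_le_card fun X hX => ?_) card_biUnion_le
    have hnn := (mem_filter.1 hX).2
    unfold IsNear at hnn
    push Not at hnn
    obtain ⟨s, hs, t, ht, hst⟩ := hnn
    rw [mem_inter] at hs ht
    exact mem_biUnion.2 ⟨(s, t), mem_product.2 ⟨hs.2, ht.2⟩,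
      mem_filter.2 ⟨hX, ⟨hs.1, ht.1⟩, hst⟩⟩
  have htot := sum_le_sum hpair
  rw [sum_add_distrib, hN, ← mul_sum, hY] at htot
  have hD' : (#𝒟 : ℝ) ≤ ∑ x ∈ P ×ˢ Q, (#{X ∈ 𝒟 | (x.1 ∈ isolated adj X ∧
      x.2 ∈ isolated adj X) ∧ Disjoint (nbrs adj W x.1) (nbrs adj W x.2)} : ℝ) := by
    exact_mod_cast hD
  have hsplit : #𝒩 + #𝒟 = #𝒳 := card_filter_add_card_filter_not _
  have : ((#𝒩 + #𝒟 : ℕ) : ℝ) ≤ (2 * #𝒴 : ℕ) := by push_cast; linarith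
  rw [← hsplit]
  exact_mod_cast this

end Main

section Counting
variable {α : Type*} [DecidableEq α] {adj : α → α → Prop} [DecidableRel adj]
  {F : Finset (Finset α)} {W X : Finset α} {u v x y : α}

theorem insert_mem_of_isolated_subset (hadj : ∀ x y, adj x y → adj y x)
    (hF : ∀ A, A ∈ F ↔ isolated adj A = ∅) (hX : isolated adj X ⊆ nbrs adj W u)
    (hne : (X ∩ nbrs adj W u).Nonempty) : insert u X ∈ F := by
  refine (hF _).2 (eq_empty_of_forall_notMem fun x hx => ?_)
  obtain ⟨hx, h⟩ := mem_isolated.1 hx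
  rcases mem_insert.1 hx with rfl | hx
  · obtain ⟨y, hy⟩ := hne
    simp only [mem_inter, mem_filter] at hy
    exact h y (mem_insert_of_mem hy.1) hy.2.2
  · have hxi : x ∈ isolated adj X := mem_isolated.2 ⟨hx, fun y hy => h y (mem_insert_of_mem hy)⟩
    exact h u (mem_insert_self _ _) (hadj _ _ (mem_filter.1 (hX hxi)).2)

theorem card_add_card_le_of_insert (hadj : ∀ x y, adj x y → adj y x)
    (hF : ∀ A, A ∈ F ↔ isolated adj A = ∅) (huW : u ∉ W) (hvW : v ∉ W) (huv : u ≠ v)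
    (𝒜 𝒴 : Finset (Finset α))
    (h𝒜 : ∀ X ∈ 𝒜, X ⊆ W ∧ isolated adj X ⊆ nbrs adj W u ∧ (isolated adj X).Nonempty)
    (h𝒴 : ∀ X ∈ 𝒴, X ⊆ W ∧ isolated adj X = ∅ ∧ (X ∩ nbrs adj W u).Nonempty) :
    #𝒜 + #𝒴 ≤ #{A ∈ F | u ∈ A ∧ v ∉ A} := by
  have hd : Disjoint 𝒜 𝒴 := disjoint_left.2 fun X h1 h2 =>
    (h𝒜 X h1).2.2.ne_empty (h𝒴 X h2).2.1
  have hW : ∀ X ∈ 𝒜 ∪ 𝒴, X ⊆ W := fun X hX =>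
    (mem_union.1 hX).elim (fun h => (h𝒜 X h).1) fun h => (h𝒴 X h).1
  rw [← card_union_of_disjoint hd]
  refine card_le_card_of_injOn (insert u) (fun X hX => ?_) fun X hX X' hX' h => ?_
  · have hv : v ∉ insert u X := by
      simpa [huv.symm] using fun h => hvW (hW X hX h)
    refine mem_filter.2 ⟨?_, mem_insert_self _ _, hv⟩
    rcases mem_union.1 hX with h | h
    · obtain ⟨-, h2, h3⟩ := h𝒜 X h
      exact insert_mem_of_isolated_subset hadj hF h2
        (h3.mono (subset_inter (isolated_subset X) h2))
    · obtain ⟨-, h2, h3⟩ := h𝒴 X h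
      exact insert_mem_of_isolated_subset hadj hF (h2 ▸ empty_subset _) h3
  · rw [← erase_insert (fun h => huW (hW X hX h)), h, erase_insert fun h => huW (hW X' hX' h)]

theorem two_mul_card_edge_le (hadj : ∀ x y, adj x y → adj y x)
    (hF : ∀ A, A ∈ F ↔ isolated adj A = ∅) (huv : u ≠ v) (V : Finset α) (hV : ∀ A ∈ F, A ⊆ V)
    (huV : u ∈ V) (hvV : v ∈ V) (hedge : adj u v)
    (hmin : ∀ x ∈ V, ∀ y ∈ V, x ≠ y → adj x y →
      #(nbrs adj V u) + #(nbrs adj V v) ≤ #(nbrs adj V x) + #(nbrs adj V y)) :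
    2 * #{A ∈ F | {u, v} ⊆ A} ≤ #F := by
  set W := V \ {u, v} with hW
  have huW : u ∉ W := by simp [hW]
  have hvW : v ∉ W := by simp [hW]
  have hWV : W ⊆ V := sdiff_subset
  set A := nbrs adj W u with hA
  set B := nbrs adj W v with hB
  have hdeg : ∀ s t : α, s ∈ V → s ∉ W → t ∉ W → adj s t →
      #(nbrs adj W t) + 1 ≤ #(nbrs adj V t) := by
    intro s t hs hsW htW hst
    rw [← card_insert_of_notMem (s := nbrs adj W t) (a := s) (by simp [hsW])]
    refine card_le_card (insert_subset (by simp [hs, hadj _ _ hst]) ?_)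
    exact filter_subset_filter _ hWV
  have hdeg' : ∀ s t x : α, V ⊆ insert s (insert t W) → ¬adj x t →
      #(nbrs adj V x) ≤ #(nbrs adj W x) + 1 := by
    intro s t x hVs hxt
    refine (card_le_card (t := insert s (nbrs adj W x)) fun y hy => ?_).trans (card_insert_le _ _)
    obtain ⟨hy, hxy⟩ := mem_filter.1 hy
    have := hVs hy
    simp only [mem_insert, mem_filter] at this ⊢
    rcases this with h | rfl | h
    · exact Or.inl h
    · exact absurd hxy hxt
    · exact Or.inr ⟨h, hxy⟩
  have hVuv : V ⊆ insert u (insert v W) := fun x hx => by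
    simp only [hW, mem_insert, mem_sdiff, mem_singleton]; tauto
  have hVvu : V ⊆ insert v (insert u W) := fun x hx => by
    simp only [hW, mem_insert, mem_sdiff, mem_singleton]; tauto
  have hdP : ∀ a ∈ A \ B, ¬adj a a → #(B \ A) + #(A ∩ B) ≤ #(nbrs adj W a) := by
    intro a ha _
    simp only [hA, hB, mem_sdiff, mem_filter, not_and] at ha
    have h1 := hmin u huV a (hWV ha.1.1) (fun h => huW (h ▸ ha.1.1)) ha.1.2
    have h2 := hdeg u v huV huW hvW hedge
    rw [← hB] at h2
    have h3 := hdeg' u v a hVuv fun h => ha.2 ha.1.1 (hadj _ _ h)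
    rw [inter_comm, card_sdiff_add_card_inter]
    omega
  have hdQ : ∀ b ∈ B \ A, ¬adj b b → #(A \ B) + #(A ∩ B) ≤ #(nbrs adj W b) := by
    intro b hb _
    simp only [hA, hB, mem_sdiff, mem_filter, not_and] at hb
    have h1 := hmin v hvV b (hWV hb.1.1) (fun h => hvW (h ▸ hb.1.1)) hb.1.2
    have h2 := hdeg v u hvV hvW huW (hadj _ _ hedge)
    rw [← hA] at h2
    have h3 := hdeg' v u b hVvu fun h => hb.2 hb.1.1 (hadj _ _ h)
    rw [card_sdiff_add_card_inter]
    omega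
  set 𝒳 := {X ∈ W.powerset | isolated adj X ⊆ A ∪ B ∧ (isolated adj X ∩ (A \ B)).Nonempty ∧
    (isolated adj X ∩ (B \ A)).Nonempty} with h𝒳
  set 𝒴 := {Y ∈ W.powerset | isolated adj Y = ∅ ∧ (Y ∩ (A \ B)).Nonempty ∧
    (Y ∩ (B \ A)).Nonempty} with h𝒴
  have hcore : #𝒳 ≤ 2 * #𝒴 := by
    refine card_isolated_le_two_mul (C := A ∩ B) hadj disjoint_sdiff_sdiff
      (disjoint_sdiff_inter A B) (by rw [inter_comm]; exact disjoint_sdiff_inter B A) hdP hdQ 𝒳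
      fun X hX => ?_
    simp only [h𝒳, mem_filter, mem_powerset] at hX
    refine ⟨hX.1, hX.2.1.trans fun x hx => ?_, hX.2.2⟩
    simp only [mem_union, mem_sdiff, mem_inter] at hx ⊢
    tauto
  set 𝒜 := {X ∈ W.powerset | isolated adj X ⊆ A ∧ (isolated adj X).Nonempty} with h𝒜
  set ℬ := {X ∈ W.powerset | isolated adj X ⊆ B ∧ (isolated adj X).Nonempty} with hℬ
  set ℰ := {X ∈ W.powerset | isolated adj X = ∅} with hℰ
  have hAc : #𝒜 + #𝒴 ≤ #{A ∈ F | u ∈ A ∧ v ∉ A} := by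
    refine card_add_card_le_of_insert hadj hF huW hvW huv 𝒜 𝒴 (fun X hX => ?_) fun X hX => ?_
    · simpa [h𝒜] using hX
    · simp only [h𝒴, mem_filter, mem_powerset] at hX
      exact ⟨hX.1, hX.2.1, hX.2.2.1.mono (inter_subset_inter_left sdiff_subset)⟩
  have hBc : #ℬ + #𝒴 ≤ #{A ∈ F | v ∈ A ∧ u ∉ A} := by
    refine card_add_card_le_of_insert hadj hF hvW huW huv.symm ℬ 𝒴 (fun X hX => ?_) fun X hX => ?_
    · simpa [hℬ] using hX
    · simp only [h𝒴, mem_filter, mem_powerset] at hX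
      exact ⟨hX.1, hX.2.1, hX.2.2.2.mono (inter_subset_inter_left sdiff_subset)⟩
  have hEc : #ℰ ≤ #{A ∈ F | u ∉ A ∧ v ∉ A} := by
    refine card_le_card fun X hX => ?_
    simp only [hℰ, mem_filter, mem_powerset] at hX
    exact mem_filter.2 ⟨(hF X).2 hX.2, fun h => huW (hX.1 h), fun h => hvW (hX.1 h)⟩
  have hUc : #{A ∈ F | u ∈ A ∧ v ∈ A} ≤ #(𝒳 ∪ (𝒜 ∪ ℬ ∪ ℰ)) := by
    refine card_le_card_of_injOn (· \ {u, v}) (fun Y hY => ?_) fun Y hY Y' hY' h => ?_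
    · obtain ⟨hYF, huY, hvY⟩ := mem_filter.1 hY
      have hYW : Y \ {u, v} ⊆ W := sdiff_subset_sdiff (hV Y hYF) Subset.rfl
      have hi : isolated adj (Y \ {u, v}) ⊆ A ∪ B := by
        intro x hx
        obtain ⟨hxY, hx⟩ := mem_isolated.1 hx
        have hxW := hYW hxY
        have hxn : x ∉ isolated adj Y := (hF Y).1 hYF ▸ notMem_empty x
        simp only [mem_isolated, not_and, not_forall, not_not] at hxn
        obtain ⟨y, hy, hxy⟩ := hxn (mem_sdiff.1 hxY).1
        have hyuv : y = u ∨ y = v := by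
          by_contra h
          exact hx y (by simp [hy, h]) hxy
        rcases hyuv with rfl | rfl
        · exact mem_union_left _ (mem_filter.2 ⟨hxW, hadj _ _ hxy⟩)
        · exact mem_union_right _ (mem_filter.2 ⟨hxW, hadj _ _ hxy⟩)
      simp only [coe_union, Set.mem_union, mem_coe, h𝒳, h𝒜, hℬ, hℰ, mem_filter, mem_powerset, hYW,
        true_and, hi]
      rcases (isolated adj (Y \ {u, v})).eq_empty_or_nonempty with h0 | h0
      · exact Or.inr (Or.inr h0)
      rcases (isolated adj (Y \ {u, v}) ∩ (A \ B)).eq_empty_or_nonempty with h1 | h1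
      · refine Or.inr (Or.inl (Or.inr ⟨fun x hx => ?_, h0⟩))
        by_contra hxB
        have hxA := (mem_union.1 (hi hx)).resolve_right hxB
        exact notMem_empty x (h1 ▸ mem_inter.2 ⟨hx, mem_sdiff.2 ⟨hxA, hxB⟩⟩)
      rcases (isolated adj (Y \ {u, v}) ∩ (B \ A)).eq_empty_or_nonempty with h2 | h2
      · refine Or.inr (Or.inl (Or.inl ⟨fun x hx => ?_, h0⟩))
        by_contra hxA
        have hxB := (mem_union.1 (hi hx)).resolve_left hxA
        exact notMem_empty x (h2 ▸ mem_inter.2 ⟨hx, mem_sdiff.2 ⟨hxB, hxA⟩⟩)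
      exact Or.inl ⟨h1, h2⟩
    · have huvY : ∀ Y ∈ ({A ∈ F | u ∈ A ∧ v ∈ A} : Finset (Finset α)), {u, v} ⊆ Y := fun Y hY =>
        insert_subset (mem_filter.1 hY).2.1 (singleton_subset_iff.2 (mem_filter.1 hY).2.2)
      dsimp only at h
      rw [← sdiff_union_of_subset (huvY Y hY), h, sdiff_union_of_subset (huvY Y' hY')]
  have hUc' := hUc.trans ((card_union_le _ _).trans (Nat.add_le_add_left
    ((card_union_le _ _).trans (Nat.add_le_add_right (card_union_le _ _) _)) _))
  have hset : ({A ∈ F | {u, v} ⊆ A} : Finset (Finset α)) = {A ∈ F | u ∈ A ∧ v ∈ A} :=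
    filter_congr fun A _ => by simp [insert_subset_iff]
  have hs1 := card_filter_add_card_filter_not (s := F) (fun A => u ∈ A)
  have hs2 := card_filter_add_card_filter_not (s := {A ∈ F | u ∈ A}) (fun A => v ∈ A)
  have hs3 := card_filter_add_card_filter_not (s := {A ∈ F | u ∉ A}) (fun A => v ∈ A)
  simp only [filter_filter] at hs2 hs3
  have hs4 : ({A ∈ F | v ∈ A ∧ u ∉ A} : Finset (Finset α)) = {A ∈ F | u ∉ A ∧ v ∈ A} :=
    filter_congr fun A _ => and_comm
  rw [hset]
  rw [hs4] at hBc
  omega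

end Counting

section Generators
variable {α : Type*} [DecidableEq α] {F : Finset (Finset α)}

theorem exists_mem_gens_subset {A : Finset α} (hA : A ∈ F) {x : α} (hx : x ∈ A) :
    ∃ G ∈ gens F, x ∈ G ∧ G ⊆ A := by
  induction A using Finset.strongInduction with
  | H A ih =>
    by_cases h : (F.filter (fun B => B ⊂ A)).sup id = A
    · rw [← h] at hx
      obtain ⟨B, hB, hxB⟩ := mem_sup.1 hx
      obtain ⟨hBF, hBA⟩ := mem_filter.1 hB
      obtain ⟨G, hG, hxG, hGB⟩ := ih B hBA hBF hxB
      exact ⟨G, hG, hxG, hGB.trans hBA.subset⟩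
    · exact ⟨A, mem_filter.2 ⟨hA, ⟨x, hx⟩, h⟩, hx, Subset.rfl⟩

theorem mem_iff_isolated_eq_empty (hUC : UnionClosed F) (hempty : ∅ ∈ F)
    (hgraph : ∀ V ∈ gens F, V.card = 1 ∨ V.card = 2) (A : Finset α) :
    A ∈ F ↔ isolated (fun x y => {x, y} ∈ gens F) A = ∅ := by
  constructor
  · refine fun hA => eq_empty_of_forall_notMem fun x hx => ?_
    obtain ⟨hx, h⟩ := mem_isolated.1 hx
    obtain ⟨G, hG, hxG, hGA⟩ := exists_mem_gens_subset hA hx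
    rcases hgraph G hG with h1 | h2
    · obtain ⟨z, rfl⟩ := card_eq_one.1 h1
      obtain rfl := mem_singleton.1 hxG
      exact h x hx (by simpa using hG)
    · obtain ⟨y, z, -, rfl⟩ := card_eq_two.1 h2
      rcases mem_insert.1 hxG with rfl | hxz
      · exact h z (hGA (by simp)) hG
      · obtain rfl := mem_singleton.1 hxz
        exact h y (hGA (by simp)) (by rwa [pair_comm])
  · intro hA
    have hsup : ((gens F).filter (· ⊆ A)).sup id ∈ F :=
      sup_induction (p := (· ∈ F)) hempty hUC fun G hG =>
        (mem_filter.1 (mem_filter.1 hG).1).1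
    convert hsup using 1
    refine Subset.antisymm (fun x hx => ?_) (Finset.sup_le fun G hG => (mem_filter.1 hG).2)
    have hxi : x ∉ isolated (fun x y => {x, y} ∈ gens F) A := hA ▸ notMem_empty x
    simp only [mem_isolated, not_and, not_forall, not_not] at hxi
    obtain ⟨y, hy, hxy⟩ := hxi hx
    exact mem_sup.2 ⟨{x, y}, mem_filter.2 ⟨hxy, by simp [insert_subset_iff, hx, hy]⟩, by simp⟩

end Generators

/-- Theorem 3.1: if `F` is a graph-generated union-closed family with `∅ ∈ F`
and at least two members, then some generator `U ∈ J(F)` satisfies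
`|{A ∈ F : U ⊆ A}| ≤ |F| / 2`. -/
theorem stmt5 {α : Type*} [DecidableEq α] (F : Finset (Finset α))
    (hUC : UnionClosed F) (hempty : ∅ ∈ F) (hcard : 2 ≤ F.card)
    (hgraph : ∀ V ∈ gens F, V.card = 1 ∨ V.card = 2) :
    ∃ U ∈ gens F, 2 * (F.filter (fun A => U ⊆ A)).card ≤ F.card := by
  have hF := mem_iff_isolated_eq_empty hUC hempty hgraph
  have hadj : ∀ x y : α, {x, y} ∈ gens F → {y, x} ∈ gens F := fun x y h => by rwa [pair_comm]
  by_cases hex : ∃ u v, u ≠ v ∧ {u, v} ∈ gens F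
  · have hV : ∀ A ∈ F, A ⊆ F.sup id := fun A hA => le_sup (f := id) hA
    have hmemV : ∀ u v, {u, v} ∈ gens F → u ∈ F.sup id ∧ v ∈ F.sup id := fun u v h =>
      insert_subset_iff.1 (hV _ (mem_filter.1 h).1) |>.imp_right singleton_subset_iff.1
    set E := {x ∈ F.sup id ×ˢ F.sup id | x.1 ≠ x.2 ∧ {x.1, x.2} ∈ gens F} with hE
    have hEne : E.Nonempty := by
      obtain ⟨u, v, huv, h⟩ := hex
      exact ⟨(u, v), mem_filter.2 ⟨mem_product.2 (hmemV u v h), huv, h⟩⟩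
    obtain ⟨⟨u, v⟩, huv, hmin⟩ := exists_min_image E (fun x =>
      #(nbrs (fun x y => {x, y} ∈ gens F) (F.sup id) x.1) +
        #(nbrs (fun x y => {x, y} ∈ gens F) (F.sup id) x.2)) hEne
    obtain ⟨h1, h2, h3⟩ := mem_filter.1 huv
    obtain ⟨hu, hv⟩ := mem_product.1 h1
    exact ⟨{u, v}, h3, two_mul_card_edge_le hadj hF h2 (F.sup id) hV hu hv h3
      fun x hx y hy hxy h => hmin (x, y) (mem_filter.2 ⟨mem_product.2 ⟨hx, hy⟩, hxy, h⟩)⟩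
  · have hloop : ∀ x y, {x, y} ∈ gens F → x = y := fun x y h => by
      by_contra hxy
      exact hex ⟨x, y, hxy, h⟩
    obtain ⟨A, hA, hA0⟩ := exists_mem_ne (one_lt_two.trans_le hcard) ∅
    obtain ⟨x, hx⟩ := nonempty_iff_ne_empty.2 hA0
    have hadjm : ∀ A ∈ F, ∀ x ∈ A, {x} ∈ gens F := by
      intro A hA x hx
      have hxi : x ∉ isolated (fun x y => {x, y} ∈ gens F) A := (hF A).1 hA ▸ notMem_empty x
      simp only [mem_isolated, not_and, not_forall, not_not] at hxi
      obtain ⟨y, hy, hxy⟩ := hxi hx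
      obtain rfl := hloop x y hxy
      simpa using hxy
    refine ⟨{x}, hadjm A hA x hx, ?_⟩
    have hle : #{A ∈ F | {x} ⊆ A} ≤ #{A ∈ F | ¬{x} ⊆ A} := by
      refine card_le_card_of_injOn (erase · x) (fun B hB => ?_) fun B hB B' hB' h => ?_
      · obtain ⟨hBF, -⟩ := mem_filter.1 hB
        refine mem_filter.2 ⟨(hF _).2 (eq_empty_of_forall_notMem fun z hz => ?_), by simp⟩
        obtain ⟨hz, h⟩ := mem_isolated.1 hz
        exact h z hz (by simpa using hadjm B hBF z (mem_of_mem_erase hz))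
      · have h1 := singleton_subset_iff.1 (mem_filter.1 hB).2
        have h2 := singleton_subset_iff.1 (mem_filter.1 hB').2
        dsimp only at h
        rw [← insert_erase h1, h, insert_erase h2]
    have := card_filter_add_card_filter_not (s := F) (fun A => {x} ⊆ A)
    omega
end

section
/- Let F be a finite union-closed family of finite sets with ∅ ∈ F, let U be a finite set, and let X be a set with X ∩ U = ∅. Then a set Y ⊆ U belongs to E_{F,U}(X) if and only if: (i)' for every x ∈ Y there exists V ∈ J(F) with x ∈ V ⊆ X ∪ Y, and (ii)'' for every V ∈ J(F) with V ∖ U ⊆ X and every x ∈ V ∖ U there exists V' ∈ J(F) with x ∈ V' ⊆ X ∪ Y. -/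
open Finset

theorem mem_piF {α : Type*} [DecidableEq α] {F : Finset (Finset α)} {X : Finset α} {x : α} :
    x ∈ piF F X ↔ ∃ A ∈ F, x ∈ A ∧ A ⊆ X := by
  simp only [piF, mem_sup, mem_filter, id]
  tauto

/-- Every element of a member of `F` lies in a generator contained in that member. -/
theorem exists_mem_gens_of_mem {α : Type*} [DecidableEq α] {F : Finset (Finset α)} {x : α}
    (A : Finset α) (hA : A ∈ F) (hx : x ∈ A) : ∃ V ∈ gens F, x ∈ V ∧ V ⊆ A := by
  induction A using Finset.strongInduction with
  | H A ih =>
    by_cases h : (F.filter (fun B => B ⊂ A)).sup id = A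
    · rw [← h] at hx
      simp only [mem_sup, mem_filter, id] at hx
      obtain ⟨B, ⟨hB, hBA⟩, hxB⟩ := hx
      obtain ⟨V, hV, hxV, hVB⟩ := ih B hBA hB hxB
      exact ⟨V, hV, hxV, hVB.trans hBA.subset⟩
    · exact ⟨A, mem_filter.2 ⟨hA, ⟨x, hx⟩, h⟩, hx, Subset.rfl⟩

theorem mem_piF_iff_exists_gens {α : Type*} [DecidableEq α] {F : Finset (Finset α)}
    {X : Finset α} {x : α} : x ∈ piF F X ↔ ∃ V ∈ gens F, x ∈ V ∧ V ⊆ X := by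
  rw [mem_piF]
  constructor
  · rintro ⟨A, hA, hx, hAX⟩
    obtain ⟨V, hV, hxV, hVA⟩ := exists_mem_gens_of_mem A hA hx
    exact ⟨V, hV, hxV, hVA.trans hAX⟩
  · rintro ⟨V, hV, h⟩
    exact ⟨V, (mem_filter.1 hV).1, h⟩

theorem piF_subset {α : Type*} [DecidableEq α] (F : Finset (Finset α)) (X : Finset α) :
    piF F X ⊆ X := by
  intro x hx
  obtain ⟨A, -, hxA, hAX⟩ := mem_piF.1 hx
  exact hAX hxA

/-- Lemma 3.10: `Y ∈ E_{F,U}(X)` iff (i)' every `x ∈ Y` lies in some generator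
`V ⊆ X ∪ Y`, and (ii)'' for every generator `V` with `V ∖ U ⊆ X` and every
`x ∈ V ∖ U` there is a generator `V'` with `x ∈ V' ⊆ X ∪ Y`. -/
theorem stmt7 {α : Type*} [DecidableEq α] (F : Finset (Finset α))
    (hUC : UnionClosed F) (hempty : ∅ ∈ F) (U X : Finset α) (hXU : X ∩ U = ∅)
    (Y : Finset α) (hY : Y ⊆ U) :
    Y ∈ Efam F U X ↔
      ((∀ x ∈ Y, ∃ V ∈ gens F, x ∈ V ∧ V ⊆ X ∪ Y) ∧
        (∀ V ∈ gens F, V \ U ⊆ X → ∀ x ∈ V \ U,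
          ∃ V' ∈ gens F, x ∈ V' ∧ V' ⊆ X ∪ Y)) := by
  have hdisj : ∀ x ∈ X, x ∉ U := fun x hx hxU => by
    simpa [hXU] using mem_inter.2 ⟨hx, hxU⟩
  have hsub : ∀ V : Finset α, V \ U ⊆ X ↔ V ⊆ X ∪ U := fun V => by
    rw [union_comm]
    exact sdiff_le_iff
  simp only [Efam, mem_filter, mem_powerset, hY, true_and, ← mem_piF_iff_exists_gens, hsub]
  refine and_congr ⟨fun h x hx => ?_, fun h => ?_⟩ ⟨fun h V hV hVX x hx => ?_, fun h x hx => ?_⟩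
  · rw [← h] at hx
    exact (mem_inter.1 hx).1
  · ext x
    refine ⟨fun hx => ?_, fun hx => mem_inter.2 ⟨h x hx, hY hx⟩⟩
    obtain ⟨hxp, hxU⟩ := mem_inter.1 hx
    exact (mem_union.1 (piF_subset F _ hxp)).resolve_left fun hxX => hdisj x hxX hxU
  · obtain ⟨hxV, hxU⟩ := mem_sdiff.1 hx
    exact h (mem_sdiff.2 ⟨mem_piF_iff_exists_gens.2 ⟨V, hV, hxV, hVX⟩, hxU⟩)
  · obtain ⟨hxp, hxU⟩ := mem_sdiff.1 hx
    obtain ⟨V, hV, hxV, hVX⟩ := mem_piF_iff_exists_gens.1 hxp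
    exact h V hV hVX x (mem_sdiff.2 ⟨hxV, hxU⟩)
end

section
/- Let F be a finite union-closed family of finite sets with ∅ ∈ F and let U ⊆ ⋃F. Then F is an extension of (𝒩³_F(U), U); explicitly, F = 𝒩³_F(U) ∨ H where H is the union-closed family generated by ∅ together with the generators V ∈ J(F) with V ∉ 𝒩³_F(U), and (⋃H) ∩ U = ∅. -/
open Finset

section

variable {α : Type*} [DecidableEq α]

lemma mem_genUC {G : Finset (Finset α)} {X : Finset α} :
    X ∈ genUC G ↔ ∃ S ⊆ G, S.sup id = X := by
  simp [genUC]

lemma empty_mem_genUC (G : Finset (Finset α)) : ∅ ∈ genUC G :=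
  mem_genUC.2 ⟨∅, empty_subset G, by simp⟩

lemma subset_genUC (G : Finset (Finset α)) : G ⊆ genUC G := fun V hV =>
  mem_genUC.2 ⟨{V}, by simpa using hV, by simp⟩

lemma unionClosed_genUC (G : Finset (Finset α)) : UnionClosed (genUC G) := by
  intro A hA B hB
  obtain ⟨S, hS, rfl⟩ := mem_genUC.1 hA
  obtain ⟨T, hT, rfl⟩ := mem_genUC.1 hB
  exact mem_genUC.2 ⟨S ∪ T, union_subset hS hT, by rw [sup_union]; rfl⟩

lemma UnionClosed.sup_mem {K : Finset (Finset α)} (hK : UnionClosed K) (h0 : ∅ ∈ K)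
    {S : Finset (Finset α)} (hS : S ⊆ K) : S.sup id ∈ K :=
  sup_induction (p := (· ∈ K)) h0 hK fun _ hV => hS hV

lemma UnionClosed.genUC_subset {K : Finset (Finset α)} (hK : UnionClosed K) (h0 : ∅ ∈ K)
    {G : Finset (Finset α)} (hG : G ⊆ K) : genUC G ⊆ K := by
  intro X hX
  obtain ⟨S, hS, rfl⟩ := mem_genUC.1 hX
  exact hK.sup_mem h0 (hS.trans hG)

lemma sup_genUC (G : Finset (Finset α)) : (genUC G).sup id = G.sup id := by
  refine le_antisymm (Finset.sup_le fun X hX => ?_) (sup_mono (subset_genUC G))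
  obtain ⟨S, hS, rfl⟩ := mem_genUC.1 hX
  exact sup_mono hS

lemma gens_subset (F : Finset (Finset α)) : gens F ⊆ F := filter_subset _ _

/-- Every member of a finite family is a union of generators of the family. -/
lemma subset_genUC_gens (F : Finset (Finset α)) : F ⊆ genUC (gens F) := by
  intro A
  induction A using Finset.strongInduction with
  | H A ih =>
    intro hA
    by_cases hg : A ∈ gens F
    · exact subset_genUC _ hg
    · rcases A.eq_empty_or_nonempty with rfl | hne
      · exact empty_mem_genUC _
      · have hsup : (F.filter (fun B => B ⊂ A)).sup id = A := by
          by_contra h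
          exact hg (mem_filter.2 ⟨hA, hne, h⟩)
        rw [← hsup]
        refine (unionClosed_genUC _).sup_mem (empty_mem_genUC _) fun B hB => ?_
        exact ih B (mem_filter.1 hB).2 (mem_filter.1 hB).1

lemma mem_famJoin {F H : Finset (Finset α)} {X : Finset α} :
    X ∈ famJoin F H ↔ ∃ A ∈ F, ∃ B ∈ H, A ∪ B = X := by
  simp [famJoin, and_assoc]

lemma UnionClosed.famJoin {F H : Finset (Finset α)} (hF : UnionClosed F) (hH : UnionClosed H) :
    UnionClosed (famJoin F H) := by
  intro X hX Y hY
  obtain ⟨A, hA, B, hB, rfl⟩ := mem_famJoin.1 hX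
  obtain ⟨C, hC, D, hD, rfl⟩ := mem_famJoin.1 hY
  exact mem_famJoin.2 ⟨A ∪ C, hF A hA C hC, B ∪ D, hH B hB D hD, union_union_union_comm A C B D⟩

/-- A union-closed family is the join of any subfamily of the form `genUC G` with the family
generated by the remaining generators. -/
lemma UnionClosed.eq_famJoin_genUC {F G : Finset (Finset α)} (hF : UnionClosed F) (h0 : ∅ ∈ F)
    (hG : G ⊆ F) :
    F = _root_.famJoin (genUC G) (genUC ((gens F).filter (fun V => V ∉ genUC G))) := by
  apply Subset.antisymm
  · refine (subset_genUC_gens F).trans <|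
      ((unionClosed_genUC _).famJoin (unionClosed_genUC _)).genUC_subset
        (mem_famJoin.2 ⟨∅, empty_mem_genUC _, ∅, empty_mem_genUC _, union_empty _⟩) fun V hV => ?_
    by_cases hVG : V ∈ genUC G
    · exact mem_famJoin.2 ⟨V, hVG, ∅, empty_mem_genUC _, union_empty V⟩
    · exact mem_famJoin.2 ⟨∅, empty_mem_genUC _, V,
        subset_genUC _ (mem_filter.2 ⟨hV, hVG⟩), empty_union V⟩
  · intro X hX
    obtain ⟨A, hA, B, hB, rfl⟩ := mem_famJoin.1 hX
    exact hF A (hF.genUC_subset h0 hG hA) B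
      (hF.genUC_subset h0 ((filter_subset _ _).trans (gens_subset F)) hB)

lemma mem_latNbhd_of_mem_gens {F : Finset (Finset α)} {U V : Finset α} (hV : V ∈ gens F)
    (hVU : (V ∩ U).Nonempty) : V ∈ latNbhd F U :=
  subset_genUC _ (mem_filter.2 ⟨hV, hVU⟩)

lemma mem_latNbhd3_of_mem_gens {F : Finset (Finset α)} {U V : Finset α} (hV : V ∈ gens F)
    (hVU : (V ∩ U).Nonempty) : V ∈ latNbhd3 F U := by
  refine mem_latNbhd_of_mem_gens hV ?_
  have hsub : V ⊆ (latNbhd F U).sup id :=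
    le_sup (f := id) (mem_latNbhd_of_mem_gens hV hVU)
  rw [inter_eq_left.2 hsub]
  exact hVU.mono inter_subset_left

end

/-- Lemma 3.11: `F` is an extension of `(𝒩³_F(U), U)`; explicitly
`F = 𝒩³_F(U) ∨ H` where `H` is the union-closed family generated by `∅`
and the generators `V ∈ J(F)` with `V ∉ 𝒩³_F(U)`, and `(⋃ H) ∩ U = ∅`. -/
theorem stmt8 {α : Type*} [DecidableEq α] (F : Finset (Finset α))
    (hUC : UnionClosed F) (hempty : ∅ ∈ F) (U : Finset α) (hU : U ⊆ F.sup id) :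
    IsExtension (latNbhd3 F U) U F ∧
      F = famJoin (latNbhd3 F U) (genUC ((gens F).filter (fun V => V ∉ latNbhd3 F U))) ∧
      ((genUC ((gens F).filter (fun V => V ∉ latNbhd3 F U))).sup id) ∩ U = ∅ := by
  have hjoin : F = famJoin (latNbhd3 F U)
      (genUC ((gens F).filter (fun V => V ∉ latNbhd3 F U))) :=
    hUC.eq_famJoin_genUC hempty ((filter_subset _ _).trans (gens_subset F))
  have hdisj : ((genUC ((gens F).filter (fun V => V ∉ latNbhd3 F U))).sup id) ∩ U = ∅ := by
    rw [sup_genUC, ← disjoint_iff_inter_eq_empty, Finset.disjoint_sup_left]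
    intro V hV
    obtain ⟨hVg, hVn⟩ := mem_filter.1 hV
    rw [id, disjoint_iff_inter_eq_empty, ← not_nonempty_iff_eq_empty]
    exact fun h => hVn (mem_latNbhd3_of_mem_gens hVg h)
  exact ⟨⟨_, ⟨∅, empty_mem_genUC _⟩, unionClosed_genUC _, hdisj, hjoin⟩, hjoin, hdisj⟩
end

section
/- Let F be a finite union-closed family of finite sets with ∅ ∈ F, let U be a finite set, and let D be a finite set with D ⊇ ⋃F and D ∖ U ≠ ∅. Then there exists an extension F' = F ∨ H of (F, U) such that: (i) H is a filter of 2^{D∖U}, (ii) F'_{∖U} = H, and (iii) F' minimizes μ in D. -/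
open Finset

/-- `G` consists of subsets of `S` and is closed under joins with the sets `A \ U`, `A ∈ F`. -/
def IsJoinStable {α : Type*} [DecidableEq α] (F : Finset (Finset α)) (U S : Finset α)
    (G : Finset (Finset α)) : Prop :=
  G.Nonempty ∧ (∀ X ∈ G, X ⊆ S) ∧ ∀ X ∈ G, ∀ A ∈ F, X ∪ A \ U ∈ G

/-- The up-compression of a member `X` of `G` in direction `i`. -/
def upShift {α : Type*} [DecidableEq α] (G : Finset (Finset α)) (i : α) (X : Finset α) :
    Finset α :=
  if insert i X ∈ G then X else insert i X

section UpCompression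

variable {α : Type*} [DecidableEq α] {F G : Finset (Finset α)} {U S X Y : Finset α} {i : α}

theorem upShift_injOn : Set.InjOn (upShift G i) G := by
  intro X hX Y hY h
  have hX : X ∈ G := hX
  have hY : Y ∈ G := hY
  unfold upShift at h
  split_ifs at h with h1 h2 h2
  · exact h
  · exact absurd (h ▸ hX) h2
  · exact absurd (h ▸ hY) h1
  · have hiX : i ∉ X := fun hi => h1 (by rwa [insert_eq_of_mem hi])
    have hiY : i ∉ Y := fun hi => h2 (by rwa [insert_eq_of_mem hi])
    rw [← erase_insert hiX, h, erase_insert hiY]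

theorem mem_image_upShift_of_mem (hY : Y ∈ G) (h : insert i Y ∈ G) :
    Y ∈ G.image (upShift G i) :=
  mem_image.2 ⟨Y, hY, by simp [upShift, h]⟩

theorem insert_mem_image_upShift (hY : Y ∈ G) : insert i Y ∈ G.image (upShift G i) := by
  by_cases h : insert i Y ∈ G
  · exact mem_image_upShift_of_mem h (by simpa using h)
  · exact mem_image.2 ⟨Y, hY, by simp [upShift, h]⟩

theorem IsJoinStable.image_upShift (hG : IsJoinStable F U S G) (hi : i ∈ S) :
    IsJoinStable F U S (G.image (upShift G i)) := by
  obtain ⟨hne, hsub, hjoin⟩ := hG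
  refine ⟨hne.image _, ?_, ?_⟩
  · intro X hX
    obtain ⟨Y, hY, rfl⟩ := mem_image.1 hX
    unfold upShift
    split_ifs
    · exact hsub Y hY
    · exact insert_subset hi (hsub Y hY)
  · intro X hX A hA
    obtain ⟨Y, hY, rfl⟩ := mem_image.1 hX
    have hYA := hjoin Y hY A hA
    unfold upShift
    split_ifs with h
    · exact mem_image_upShift_of_mem hYA (by simpa [insert_union] using hjoin _ h A hA)
    · rw [insert_union]
      exact insert_mem_image_upShift hYA

theorem piF_insert (h : ∀ A ∈ F, A ⊆ insert i X → i ∉ A) : piF F (insert i X) = piF F X := by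
  unfold piF
  congr 1
  refine filter_congr fun A hA => ⟨fun hAX => ?_, fun hAX => hAX.trans (subset_insert _ _)⟩
  exact (subset_insert_iff_of_notMem (h A hA hAX)).1 hAX

/-- The members of `G` moved by the compression do not change their `Efam`. -/
theorem IsJoinStable.Efam_upShift (hG : IsJoinStable F U S G) (hX : X ∈ G)
    (hi : i ∉ U) : Efam F U (upShift G i X) = Efam F U X := by
  unfold upShift
  split_ifs with h
  · rfl
  have key : ∀ A ∈ F, A ⊆ insert i (X ∪ U) → i ∉ A := by
    intro A hA hAX hiA
    apply h
    convert hG.2.2 X hX A hA using 1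
    ext x
    have := @hAX x
    simp only [mem_insert, mem_union, mem_sdiff] at this ⊢
    constructor
    · rintro (rfl | hx)
      · exact Or.inr ⟨hiA, hi⟩
      · exact Or.inl hx
    · tauto
  have hpi : ∀ Y ⊆ U, piF F (insert i X ∪ Y) = piF F (X ∪ Y) := by
    intro Y hY
    rw [insert_union]
    exact piF_insert fun A hA hAX =>
      key A hA (hAX.trans (insert_subset_insert _ (union_subset_union_right hY)))
  unfold Efam
  refine filter_congr fun Y hY => ?_
  rw [hpi Y (mem_powerset.1 hY), hpi U Subset.rfl]

end UpCompression

/-- The mean of `|E_{F,U}(X)|` over `X ∈ G`. -/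
def meanEfam {α : Type*} [DecidableEq α] (F : Finset (Finset α)) (U : Finset α)
    (G : Finset (Finset α)) : ℚ :=
  (∑ X ∈ G, ((Efam F U X).card : ℚ)) / (G.card : ℚ)

section Minimizer

variable {α : Type*} [DecidableEq α] {F G H : Finset (Finset α)} {U S D : Finset α} {i : α}

theorem IsJoinStable.meanEfam_image_upShift (hG : IsJoinStable F U S G) (hi : i ∉ U) :
    meanEfam F U (G.image (upShift G i)) = meanEfam F U G := by
  unfold meanEfam
  rw [sum_image upShift_injOn, card_image_of_injOn upShift_injOn]
  congr 1
  exact sum_congr rfl fun X hX => by rw [hG.Efam_upShift hX hi]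

theorem sum_card_lt_sum_card_image_upShift {X : Finset α} (hX : X ∈ G) (h : insert i X ∉ G) :
    ∑ Y ∈ G, Y.card < ∑ Y ∈ G.image (upShift G i), Y.card := by
  rw [sum_image upShift_injOn]
  refine sum_lt_sum (fun Y _ => card_le_card ?_) ⟨X, hX, card_lt_card ?_⟩
  · unfold upShift
    split_ifs
    · exact Subset.rfl
    · exact subset_insert _ _
  · have hiX : i ∉ X := fun hi => h (by rwa [insert_eq_of_mem hi])
    simpa [upShift, h] using ssubset_insert hiX

theorem isFilterOn_of_insert_mem (hne : G.Nonempty) (hsub : ∀ X ∈ G, X ⊆ S)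
    (h : ∀ X ∈ G, ∀ i ∈ S, insert i X ∈ G) : IsFilterOn S G := by
  refine ⟨hne, hsub, fun X hX Y hXY hYS => ?_⟩
  have hunion : ∀ Z : Finset α, Z ⊆ S → X ∪ Z ∈ G := by
    intro Z
    induction Z using Finset.induction_on with
    | empty => simpa using hX
    | insert a Z _ ih =>
      intro hZ
      rw [union_insert]
      exact h _ (ih ((subset_insert _ _).trans hZ)) a (hZ (mem_insert_self _ _))
  simpa [union_eq_right.2 hXY] using hunion Y hYS

/-- The least mean over join-stable families is attained at a filter: among the minimizers,
one with the largest total size is fixed by every up-compression. -/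
theorem exists_isFilterOn_meanEfam_le (F : Finset (Finset α)) (hSU : Disjoint S U) :
    ∃ H, IsFilterOn S H ∧ ∀ G, IsJoinStable F U S G → meanEfam F U H ≤ meanEfam F U G := by
  classical
  let C := S.powerset.powerset.filter (IsJoinStable F U S)
  have mem_C : ∀ G, G ∈ C ↔ IsJoinStable F U S G := fun G => by
    simp only [C, mem_filter, and_iff_right_iff_imp, mem_powerset]
    exact fun hG X hX => mem_powerset.2 (hG.2.1 X hX)
  obtain hC | hC := C.eq_empty_or_nonempty
  · refine ⟨{S}, isFilterOn_of_insert_mem (by simp) (by simp) (by simp), fun G hG => ?_⟩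
    exact absurd ((mem_C G).2 hG) (by simp [hC])
  obtain ⟨G₀, hG₀, hmin⟩ := C.exists_min_image (meanEfam F U) hC
  obtain ⟨H, hH, hmax⟩ := (C.filter fun G => meanEfam F U G = meanEfam F U G₀).exists_max_image
    (fun G => ∑ Y ∈ G, Y.card) ⟨G₀, mem_filter.2 ⟨hG₀, rfl⟩⟩
  obtain ⟨hHC, hHmean⟩ := mem_filter.1 hH
  have hHs := (mem_C H).1 hHC
  refine ⟨H, isFilterOn_of_insert_mem hHs.1 hHs.2.1 fun X hX i hi => ?_,
    fun G hG => hHmean.trans_le (hmin G ((mem_C G).2 hG))⟩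
  by_contra hins
  have hiU : i ∉ U := disjoint_left.1 hSU hi
  refine (sum_card_lt_sum_card_image_upShift hX hins).not_ge (hmax _ (mem_filter.2 ⟨?_, ?_⟩))
  · exact (mem_C _).2 (hHs.image_upShift hi)
  · rw [hHs.meanEfam_image_upShift hiU, hHmean]

theorem IsExtension.isJoinStable_resAway (hUC : UnionClosed F) (hempty : ∅ ∈ F)
    (hG : IsExtension F U G) (hGD : G.sup id ⊆ D) :
    IsJoinStable F U (D \ U) (resAway G U) := by
  obtain ⟨H, ⟨B, hB⟩, -, -, rfl⟩ := hG
  refine ⟨?_, ?_, ?_⟩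
  · exact ((Nonempty.product ⟨∅, hempty⟩ ⟨B, hB⟩).image _).image _
  · intro X hX
    obtain ⟨Z, hZ, rfl⟩ := mem_image.1 hX
    exact sdiff_subset_sdiff ((le_sup (f := id) hZ).trans hGD) Subset.rfl
  · intro X hX A hA
    simp only [resAway, famJoin, mem_image, mem_product, Prod.exists] at hX ⊢
    obtain ⟨_, ⟨A', B', ⟨hA', hB'⟩, rfl⟩, rfl⟩ := hX
    refine ⟨_, ⟨A' ∪ A, B', ⟨hUC _ hA' _ hA, hB'⟩, rfl⟩, ?_⟩
    rw [← union_sdiff_distrib, union_right_comm]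

theorem IsFilterOn.resAway_famJoin (hempty : ∅ ∈ F) (hD : F.sup id ⊆ D)
    (hH : IsFilterOn (D \ U) H) : resAway (famJoin F H) U = H := by
  have hHU : ∀ B ∈ H, B \ U = B := fun B hB =>
    sdiff_eq_self_of_disjoint (disjoint_of_subset_left (hH.2.1 B hB) sdiff_disjoint)
  ext X
  simp only [resAway, famJoin, mem_image, mem_product, Prod.exists]
  constructor
  · rintro ⟨_, ⟨A, B, ⟨hA, hB⟩, rfl⟩, rfl⟩
    rw [union_sdiff_distrib, hHU B hB]
    exact hH.2.2 B hB _ subset_union_right (union_subset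
      (sdiff_subset_sdiff ((le_sup (f := id) hA).trans hD) Subset.rfl) (hH.2.1 B hB))
  · intro hX
    exact ⟨X, ⟨∅, X, ⟨hempty, hX⟩, empty_union X⟩, hHU X hX⟩

theorem IsFilterOn.isExtension_famJoin (F : Finset (Finset α)) (hH : IsFilterOn (D \ U) H) :
    IsExtension F U (famJoin F H) := by
  refine ⟨H, hH.1, fun A hA B hB => ?_, ?_, rfl⟩
  · exact hH.2.2 A hA _ subset_union_left (union_subset (hH.2.1 A hA) (hH.2.1 B hB))
  · exact disjoint_iff_inter_eq_empty.1 (disjoint_of_subset_left (Finset.sup_le hH.2.1)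
      sdiff_disjoint)

end Minimizer

/-- Theorem 3.13: for `D ⊇ ⋃ F` (with `D ∖ U ≠ ∅`) there is an extension
`F' = F ∨ H` of `(F, U)` such that (i) `H` is a filter of `2^{D∖U}`,
(ii) `F'_{∖U} = H`, and (iii) `F'` minimizes `μ` in `D`. -/
theorem stmt10 {α : Type*} [DecidableEq α] (F : Finset (Finset α))
    (hUC : UnionClosed F) (hempty : ∅ ∈ F) (U D : Finset α)
    (hD : F.sup id ⊆ D) (hDU : (D \ U).Nonempty) :
    ∃ H : Finset (Finset α),
      IsExtension F U (famJoin F H) ∧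
      IsFilterOn (D \ U) H ∧
      resAway (famJoin F H) U = H ∧
      MinimizesMu F U D (famJoin F H) := by
  obtain ⟨H, hH, hmin⟩ := exists_isFilterOn_meanEfam_le F (sdiff_disjoint : Disjoint (D \ U) U)
  have hres := hH.resAway_famJoin hempty hD
  refine ⟨H, hH.isExtension_famJoin F, hH, hres, Finset.sup_le fun X hX => ?_, ?_⟩
  · simp only [famJoin, mem_image, mem_product, Prod.exists] at hX
    obtain ⟨A, B, ⟨hA, hB⟩, rfl⟩ := hX
    exact union_subset ((le_sup (f := id) hA).trans hD) ((hH.2.1 B hB).trans sdiff_subset)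
  · intro G hG hGD
    have h := hmin _ (hG.isJoinStable_resAway hUC hempty hGD)
    rwa [← hres] at h
end

section
/- Let D be a finite set, U ⊆ D, let G be a finite nonempty union-closed family of subsets of D ∖ U, and let H be the filter of 2^{D∖U} generated by G (all subsets of D ∖ U containing some member of G). For X ∈ G set P(X) = {Y ∈ H : π_G(Y) = X}. Then for all X, Y ∈ G with X ⊆ Y, |P(X)| ≥ |P(Y)|. -/
open Finset

theorem subset_piF {α : Type*} [DecidableEq α] {F : Finset (Finset α)} {A X : Finset α}
    (hA : A ∈ F) (hAX : A ⊆ X) : A ⊆ piF F X :=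
  Finset.le_sup (f := id) (Finset.mem_filter.2 ⟨hA, hAX⟩)

/-- Replacing `π_F(Z)` by a smaller member `X` of `F` inside `Z` gives a set whose closure
is `X`. -/
theorem piF_union_sdiff {α : Type*} [DecidableEq α] {F : Finset (Finset α)} {X Z : Finset α}
    (hX : X ∈ F) (hXZ : X ⊆ piF F Z) : piF F (X ∪ (Z \ piF F Z)) = X := by
  refine subset_antisymm (Finset.sup_le fun A hA => ?_)
    (subset_piF hX Finset.subset_union_left)
  obtain ⟨hAF, hAsub⟩ := Finset.mem_filter.1 hA
  have hAZ : A ⊆ Z := hAsub.trans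
    (Finset.union_subset (hXZ.trans (piF_subset F Z)) Finset.sdiff_subset)
  intro a ha
  rcases Finset.mem_union.1 (hAsub ha) with h | h
  · exact h
  · exact absurd (subset_piF hAF hAZ ha) (Finset.mem_sdiff.1 h).2

/-- Lemma 3.14: with `H` the filter of `2^{D∖U}` generated by the nonempty
union-closed family `G` of subsets of `D ∖ U` and `P(X) = {Y ∈ H : π_G(Y) = X}`,
if `X, Y ∈ G` and `X ⊆ Y` then `|P(X)| ≥ |P(Y)|`. -/
theorem stmt11 {α : Type*} [DecidableEq α] (D U : Finset α) (G : Finset (Finset α))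
    (hG : UnionClosed G) (hGne : G.Nonempty) (hGsub : ∀ A ∈ G, A ⊆ D \ U)
    (H : Finset (Finset α))
    (hH : H = (D \ U).powerset.filter (fun Y => ∃ X ∈ G, X ⊆ Y))
    (P : Finset α → Finset (Finset α))
    (hP : ∀ X, P X = H.filter (fun Y => piF G Y = X)) :
    ∀ X ∈ G, ∀ Y ∈ G, X ⊆ Y → (P Y).card ≤ (P X).card := by
  intro X hX Y hY hXY
  subst hH
  simp only [hP]
  refine Finset.card_le_card_of_injOn (fun Z => X ∪ (Z \ Y)) ?_ ?_
  · intro Z hZ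
    simp only [Finset.mem_coe, Finset.mem_filter, Finset.mem_powerset] at hZ ⊢
    obtain ⟨⟨hZS, -⟩, rfl⟩ := hZ
    exact ⟨⟨Finset.union_subset (hGsub X hX) (Finset.sdiff_subset.trans hZS),
      X, hX, Finset.subset_union_left⟩, piF_union_sdiff hX hXY⟩
  · intro Z hZ W hW hZW
    have key : ∀ V ∈ ((D \ U).powerset.filter (fun Y => ∃ X ∈ G, X ⊆ Y)).filter
        (fun V => piF G V = Y), Y ∪ (X ∪ (V \ Y)) = V := by
      intro V hV
      have hYV : Y ⊆ V := (Finset.mem_filter.1 hV).2 ▸ piF_subset G V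
      rw [← Finset.union_assoc, Finset.union_eq_left.2 hXY, Finset.union_sdiff_of_subset hYV]
    rw [← key Z hZ, ← key W hW]
    exact congrArg (Y ∪ ·) hZW
end

section
/- Let F be a finite union-closed family of finite sets with ∅ ∈ F, let U be a finite set, let D be a finite set with D ⊇ ⋃F, and let G be a nonempty union-closed family of subsets of D ∖ U such that G = (F ∨ G)_{∖U}. Let H be the filter of 2^{D∖U} generated by G, and for X ∈ G set P(X) = {Y ∈ H : π_G(Y) = X}. Then for every X ∈ G and every Y ∈ P(X), E_{F,U}(Y) = E_{F,U}(X). -/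
open Finset

/-- `E_{F,U}(X)` depends only on which members of `F` lie in `X ∪ Z` for `Z ⊆ U`. -/
theorem Efam_congr {α : Type*} [DecidableEq α] {F : Finset (Finset α)} {U X Y : Finset α}
    (h : ∀ Z ⊆ U, ∀ A ∈ F, A ⊆ Y ∪ Z ↔ A ⊆ X ∪ Z) : Efam F U Y = Efam F U X := by
  have hpi : ∀ Z ⊆ U, piF F (Y ∪ Z) = piF F (X ∪ Z) := fun Z hZ => by
    unfold piF
    rw [Finset.filter_congr (h Z hZ)]
  refine Finset.filter_congr fun Z hZ => ?_
  rw [hpi Z (Finset.mem_powerset.1 hZ), hpi U Finset.Subset.rfl]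

/-- If `G` is stable under joining with `F` and removing `U`, then the part outside `U` of a
member of `F` contained in `Y ∪ U` lies in `π_G(Y)`, as soon as `π_G(Y) ∈ G`. -/
theorem sdiff_subset_piF {α : Type*} [DecidableEq α] {F G : Finset (Finset α)}
    {U Y A : Finset α} (hG : resAway (famJoin F G) U ⊆ G) (hY : piF G Y ∈ G)
    (hA : A ∈ F) (hAY : A ⊆ Y ∪ U) : A \ U ⊆ piF G Y := by
  have hmem : (A ∪ piF G Y) \ U ∈ G :=
    hG (Finset.mem_image_of_mem (· \ U)
      (Finset.mem_image.2 ⟨(A, piF G Y), Finset.mem_product.2 ⟨hA, hY⟩, rfl⟩))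
  have hsub : (A ∪ piF G Y) \ U ⊆ Y := by
    intro x hx
    have := @hAY x
    have := @piF_subset _ _ G Y x
    grind
  exact (Finset.sdiff_subset_sdiff Finset.subset_union_left Finset.Subset.rfl).trans
    (subset_piF hmem hsub)

/-- Lemma 3.15: with `G` a nonempty union-closed family of subsets of `D ∖ U`
satisfying `G = (F ∨ G)_{∖U}`, `H` the filter of `2^{D∖U}` generated by `G`,
and `P(X) = {Y ∈ H : π_G(Y) = X}`: if `Y ∈ P(X)` then `E_{F,U}(Y) = E_{F,U}(X)`. -/
theorem stmt12 {α : Type*} [DecidableEq α] (F : Finset (Finset α))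
    (hUC : UnionClosed F) (hempty : ∅ ∈ F) (U D : Finset α) (hD : F.sup id ⊆ D)
    (G : Finset (Finset α)) (hGne : G.Nonempty) (hGUC : UnionClosed G)
    (hGsub : ∀ A ∈ G, A ⊆ D \ U) (hG : G = resAway (famJoin F G) U)
    (H : Finset (Finset α))
    (hH : H = (D \ U).powerset.filter (fun Y => ∃ X ∈ G, X ⊆ Y))
    (P : Finset α → Finset (Finset α))
    (hP : ∀ X, P X = H.filter (fun Y => piF G Y = X)) :
    ∀ X ∈ G, ∀ Y ∈ P X, Efam F U Y = Efam F U X := by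
  intro X hX Y hYP
  subst hH
  rw [hP, Finset.mem_filter, Finset.mem_filter, Finset.mem_powerset] at hYP
  obtain ⟨⟨hYD, -⟩, rfl⟩ := hYP
  refine Efam_congr fun Z hZ A hA => ⟨fun h x hx => ?_, fun h =>
    h.trans (Finset.union_subset_union (piF_subset G Y) Finset.Subset.rfl)⟩
  have := @sdiff_subset_piF _ _ F G U Y A hG.ge hX hA
    (h.trans (Finset.union_subset_union Finset.Subset.rfl hZ)) x
  have := @hYD x
  have := h hx
  grind
end
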